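/- Let k, ℓ be integers with 1 ≤ ℓ < k and let ε > 0. There exist C = C(ℓ, k, ε) and n₀ such that the following holds for all n ≥ n₀ with k | n. Let H be an n-vertex k-uniform hypergraph with δ_ℓ(H) ≥ (δ⁺_{ℓ,k} + ε)·C(n−ℓ, k−ℓ), where C(n−ℓ, k−ℓ) is the binomial coefficient. Color the edges of H independently and uniformly at random with q ≥ n/k colors, and let H_{C log n / n^{k−1}} be the random sub-hypergraph in which each edge of H is retained independently with probability C log n / n^{k−1}. Then with probability 1 − o_{n→∞}(1), H_{C log n / n^{k−1}} contains a rainbow perfect matching, i.e. a perfect matching whose edges receive pairwise distinct colors. -/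

import Mathlib

open Finset
open scoped Classical

/-- The degree of a vertex subset `T` in a hypergraph `H`: the number of edges containing
`T`. -/
def degOf {n : ℕ} (H : Finset (Finset (Fin n))) (T : Finset (Fin n)) : ℕ :=
  (H.filter fun E => T ⊆ E).card

/-- `H` has a perfect matching: a set of pairwise disjoint edges covering every vertex. -/
def HasPM {n : ℕ} (H : Finset (Finset (Fin n))) : Prop :=
  ∃ M ⊆ H, (∀ E₁ ∈ M, ∀ E₂ ∈ M, E₁ ≠ E₂ → Disjoint E₁ E₂) ∧ ∀ v : Fin n, ∃ E ∈ M, v ∈ E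

/-- `t(n,k,ℓ)`: the smallest `d` such that every `n`-vertex `k`-uniform hypergraph with
minimum `ℓ`-degree at least `d` contains a perfect matching. -/
noncomputable def tPM (n k l : ℕ) : ℕ :=
  sInf {d : ℕ | ∀ H : Finset (Finset (Fin n)), (∀ E ∈ H, E.card = k) →
    (∀ T : Finset (Fin n), T.card = l → d ≤ degOf H T) → HasPM H}

/-- The probability that, when the edges of `H` are colored independently and uniformly at
random with `qc` colors and each edge of `H` is retained independently with probability
`p`, the retained sub-hypergraph contains a rainbow perfect matching. -/
noncomputable def rainbowPMProb (n qc : ℕ) (p : ℝ) (H : Finset (Finset (Fin n))) : ℝ :=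
  ∑ R ∈ H.powerset,
    ∑ c : Finset (Fin n) → Fin qc,
      p ^ R.card * (1 - p) ^ (H.card - R.card) *
        ((qc : ℝ) ^ Fintype.card (Finset (Fin n)))⁻¹ *
        (if ∃ M ⊆ R, (∀ E₁ ∈ M, ∀ E₂ ∈ M, E₁ ≠ E₂ → Disjoint E₁ E₂) ∧
            (∀ v : Fin n, ∃ E ∈ M, v ∈ E) ∧
            (∀ E₁ ∈ M, ∀ E₂ ∈ M, c E₁ = c E₂ → E₁ = E₂)
          then 1 else 0)

section Bernoulli

variable {α : Type*}

/-- Expectation of `f W`, where `W` is a random subset of `X` containing each element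
independently with probability `q`. -/
noncomputable def bern (q : ℝ) (X : Finset α) (f : Finset α → ℝ) : ℝ :=
  ∑ W ∈ X.powerset, q ^ W.card * (1 - q) ^ (X.card - W.card) * f W

lemma bern_empty (q : ℝ) (f : Finset α → ℝ) : bern q ∅ f = f ∅ := by
  simp [bern]

lemma bern_weight_nonneg {q : ℝ} (h0 : 0 ≤ q) (h1 : q ≤ 1) (a b : ℕ) :
    0 ≤ q ^ a * (1 - q) ^ b :=
  mul_nonneg (pow_nonneg h0 _) (pow_nonneg (by linarith) _)

lemma bern_mono {q : ℝ} (h0 : 0 ≤ q) (h1 : q ≤ 1) {X : Finset α} {f g : Finset α → ℝ}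
    (h : ∀ W ⊆ X, f W ≤ g W) : bern q X f ≤ bern q X g :=
  Finset.sum_le_sum fun W hW =>
    mul_le_mul_of_nonneg_left (h W (mem_powerset.1 hW)) (bern_weight_nonneg h0 h1 _ _)

lemma bern_add (q : ℝ) (X : Finset α) (f g : Finset α → ℝ) :
    bern q X (fun W => f W + g W) = bern q X f + bern q X g := by
  simp only [bern, mul_add, Finset.sum_add_distrib]

lemma bern_mul (q : ℝ) (X : Finset α) (c : ℝ) (f : Finset α → ℝ) :
    bern q X (fun W => c * f W) = c * bern q X f := by
  simp only [bern, Finset.mul_sum]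
  exact Finset.sum_congr rfl fun W _ => by ring

lemma bern_sum {ι : Type*} (q : ℝ) (X : Finset α) (s : Finset ι) (f : ι → Finset α → ℝ) :
    bern q X (fun W => ∑ i ∈ s, f i W) = ∑ i ∈ s, bern q X (f i) := by
  simp only [bern, Finset.mul_sum]
  exact Finset.sum_comm

/-- A family with a cheap cover: `U` covers `F`, and has cost at most `c`. -/
def HasCover (p : ℝ) (F : Finset (Finset α)) (c : ℝ) : Prop :=
  ∃ U : Finset (Finset α), (∀ S ∈ F, ∃ T ∈ U, T ⊆ S) ∧ ∑ T ∈ U, p ^ T.card ≤ c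

lemma HasCover.mono {p : ℝ} {F : Finset (Finset α)} {c d : ℝ} (h : HasCover p F c) (hcd : c ≤ d) :
    HasCover p F d := by
  obtain ⟨U, h1, h2⟩ := h
  exact ⟨U, h1, h2.trans hcd⟩

variable [DecidableEq α]

lemma bern_insert (q : ℝ) {X : Finset α} {a : α} (ha : a ∉ X) (f : Finset α → ℝ) :
    bern q (insert a X) f = (1 - q) * bern q X f + q * bern q X (fun W => f (insert a W)) := by
  unfold bern
  rw [Finset.sum_powerset_insert ha, Finset.mul_sum, Finset.mul_sum]
  congr 1
  · refine Finset.sum_congr rfl fun W hW => ?_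
    have h1 : W.card ≤ X.card := card_le_card (mem_powerset.1 hW)
    rw [card_insert_of_notMem ha, Nat.succ_sub h1, pow_succ]
    ring
  · refine Finset.sum_congr rfl fun W hW => ?_
    have h1 : a ∉ W := fun h => ha (mem_powerset.1 hW h)
    rw [card_insert_of_notMem ha, card_insert_of_notMem h1, Nat.succ_sub_succ, pow_succ]
    ring

lemma bern_const (q : ℝ) (X : Finset α) (c : ℝ) : bern q X (fun _ => c) = c := by
  induction X using Finset.induction_on with
  | empty => exact bern_empty _ _
  | insert a X ha ih => rw [bern_insert q ha, ih]; ring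

lemma bern_zero (X : Finset α) (f : Finset α → ℝ) : bern 0 X f = f ∅ := by
  induction X using Finset.induction_on generalizing f with
  | empty => exact bern_empty _ _
  | insert a X ha ih => rw [bern_insert 0 ha, ih]; ring

lemma bern_union (q r : ℝ) (X : Finset α) (f : Finset α → ℝ) :
    bern q X (fun W => bern r X (fun W' => f (W ∪ W'))) = bern (q + r - q * r) X f := by
  induction X using Finset.induction_on generalizing f with
  | empty => simp [bern_empty]
  | insert a X ha ih =>
    simp only [bern_insert _ ha, bern_add, bern_mul, Finset.insert_union, Finset.union_insert,
      Finset.insert_idem]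
    rw [ih f, ih (fun W => f (insert a W))]
    ring

lemma bern_disjoint_union (q : ℝ) (X Y : Finset α) (h : Disjoint X Y) (f : Finset α → ℝ) :
    bern q (X ∪ Y) f = bern q X (fun W => bern q Y (fun W' => f (W ∪ W'))) := by
  induction Y using Finset.induction_on generalizing f with
  | empty => simp [bern_empty]
  | insert a Y ha ih =>
    rw [Finset.disjoint_insert_right] at h
    rw [Finset.union_insert, bern_insert q (by simp [h.1, ha])]
    simp only [bern_insert _ ha, bern_add, bern_mul, Finset.union_insert]
    rw [ih h.2, ih h.2]

lemma bern_mono_prob {q r : ℝ} (h0 : 0 ≤ q) (hqr : q ≤ r) (h1 : r ≤ 1) (X : Finset α)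
    {f : Finset α → ℝ} (hf : ∀ W W', f W ≤ f (W ∪ W')) : bern q X f ≤ bern r X f := by
  rcases eq_or_lt_of_le (hqr.trans h1) with h | h
  · have : r = q := by linarith
    rw [this]
  · have hq : 0 < 1 - q := by linarith
    have hs : q + (r - q) / (1 - q) - q * ((r - q) / (1 - q)) = r := by field_simp; ring
    have hs0 : 0 ≤ (r - q) / (1 - q) := div_nonneg (by linarith) hq.le
    have hs1 : (r - q) / (1 - q) ≤ 1 := by rw [div_le_one hq]; linarith
    calc bern q X f = bern q X (fun W => bern ((r - q) / (1 - q)) X (fun _ => f W)) := by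
          simp only [bern_const]
      _ ≤ bern q X (fun W => bern ((r - q) / (1 - q)) X (fun W' => f (W ∪ W'))) :=
          bern_mono h0 h.le fun W _ => bern_mono hs0 hs1 fun W' _ => hf W W'
      _ = bern r X f := by rw [bern_union, hs]

lemma exists_le_bern {q : ℝ} (h0 : 0 ≤ q) (h1 : q ≤ 1) (X : Finset α) (f : Finset α → ℝ) :
    ∃ W ⊆ X, f W ≤ bern q X f := by
  by_contra! h
  obtain ⟨W, hW, hmin⟩ := Finset.exists_min_image X.powerset f ⟨∅, by simp⟩
  have h2 : f W ≤ bern q X f := by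
    rw [← bern_const q X (f W)]
    exact bern_mono h0 h1 fun W' hW' => hmin W' (mem_powerset.2 hW')
  exact absurd (h W (mem_powerset.1 hW)) (not_lt.2 h2)

/-- The indicator of `W` containing a member of `F`. -/
noncomputable def upInd (F : Finset (Finset α)) (W : Finset α) : ℝ :=
  if ∃ S ∈ F, S ⊆ W then 1 else 0

lemma upInd_mono {F F' : Finset (Finset α)} {W W' : Finset α}
    (h : (∃ S ∈ F, S ⊆ W) → ∃ S ∈ F', S ⊆ W') : upInd F W ≤ upInd F' W' := by
  unfold upInd
  split_ifs with h1 h2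
  · exact le_rfl
  · exact absurd (h h1) h2
  · exact zero_le_one
  · exact le_rfl

/-- The inclusion-minimal sets of the form `S \ W` with `S ∈ F`. -/
noncomputable def minFrag (F : Finset (Finset α)) (W : Finset α) : Finset (Finset α) :=
  (F.image (· \ W)).filter fun T => ∀ S ∈ F, S \ W ⊆ T → S \ W = T

lemma exists_minFrag_subset {F : Finset (Finset α)} (W : Finset α) {S : Finset α} (hS : S ∈ F) :
    ∃ T ∈ minFrag F W, T ⊆ S := by
  obtain ⟨S', hS', hmin⟩ := Finset.exists_min_image (F.filter fun S' => S' \ W ⊆ S)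
    (fun S' => (S' \ W).card) ⟨S, by simp [hS]⟩
  rw [mem_filter] at hS'
  refine ⟨S' \ W, mem_filter.2 ⟨mem_image_of_mem _ hS'.1, fun S'' h'' hsub => ?_⟩, hS'.2⟩
  exact Finset.eq_of_subset_of_card_le hsub
    (hmin S'' (mem_filter.2 ⟨h'', hsub.trans hS'.2⟩))

lemma bern_minFrag_le {X : Finset α} {F : Finset (Finset α)} (hFX : ∀ S ∈ F, S ⊆ X)
    {p q D : ℝ} (hp : 0 ≤ p) (hq : 0 < q) (hq1 : q ≤ 1) (b : ℕ)
    (hD : ∀ S ∈ F, ∑ T ∈ S.powerset with b < T.card, (p / q) ^ T.card ≤ D) (hD0 : 0 ≤ D) :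
    bern q X (fun W => ∑ T ∈ minFrag F W with b < T.card, p ^ T.card) ≤ D := by
  have hex : ∀ Z : Finset α, ∃ S : Finset α, (∃ S' ∈ F, S' ⊆ Z) → S ∈ F ∧ S ⊆ Z := by
    intro Z
    by_cases h : ∃ S' ∈ F, S' ⊆ Z
    · obtain ⟨S', h1, h2⟩ := h
      exact ⟨S', fun _ => ⟨h1, h2⟩⟩
    · exact ⟨∅, fun h' => absurd h' h⟩
  choose s hs using hex
  set A : Finset (Σ _ : Finset α, Finset α) :=
    X.powerset.sigma fun W => (minFrag F W).filter fun T => b < T.card with hA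
  set Bs : Finset (Σ _ : Finset α, Finset α) :=
    X.powerset.sigma fun Z => if ∃ S' ∈ F, S' ⊆ Z then
      (s Z).powerset.filter (fun T => b < T.card) else ∅ with hBs
  set w : Finset α → ℝ := fun Z => q ^ Z.card * (1 - q) ^ (X.card - Z.card) with hw
  have key : ∀ W ⊆ X, ∀ T ∈ minFrag F W, Disjoint W T ∧ T ⊆ X ∧ (∃ S' ∈ F, S' ⊆ W ∪ T) ∧
      T ⊆ s (W ∪ T) := by
    intro W hW T hT
    obtain ⟨h1, h2⟩ := mem_filter.1 hT
    obtain ⟨S, hS, rfl⟩ := mem_image.1 h1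
    have h3 : ∃ S' ∈ F, S' ⊆ W ∪ (S \ W) := ⟨S, hS, by simp [subset_union_right]⟩
    have h4 := hs _ h3
    refine ⟨disjoint_sdiff, sdiff_subset.trans (hFX S hS), h3, ?_⟩
    have h5 := h2 _ h4.1 (by
      intro x hx
      rw [mem_sdiff] at hx
      have := h4.2 hx.1
      rw [mem_union] at this
      tauto)
    exact (Finset.subset_of_eq h5.symm).trans sdiff_subset
  have step1 : bern q X (fun W => ∑ T ∈ minFrag F W with b < T.card, p ^ T.card)
      = ∑ x ∈ A, w x.1 * p ^ x.2.card := by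
    rw [hA, Finset.sum_sigma]
    simp only [bern, Finset.mul_sum, hw]
  have step2 : ∑ x ∈ A, w x.1 * p ^ x.2.card ≤ ∑ y ∈ Bs, w y.1 * (p / q) ^ y.2.card := by
    calc ∑ x ∈ A, w x.1 * p ^ x.2.card
        ≤ ∑ x ∈ A, w (x.1 ∪ x.2) * (p / q) ^ x.2.card := by
          refine Finset.sum_le_sum fun x hx => ?_
          obtain ⟨hx1, hx2⟩ := mem_sigma.1 hx
          obtain ⟨hd, hTX, -, -⟩ := key _ (mem_powerset.1 hx1) _ (mem_filter.1 hx2).1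
          have hle : x.1.card + x.2.card ≤ X.card := by
            rw [← card_union_of_disjoint hd]
            exact card_le_card (union_subset (mem_powerset.1 hx1) hTX)
          have e1 : X.card - x.1.card = (X.card - (x.1.card + x.2.card)) + x.2.card := by omega
          simp only [hw]
          rw [card_union_of_disjoint hd, e1, pow_add, pow_add, div_pow]
          have hqt : q ^ x.2.card ≠ 0 := (pow_pos hq _).ne'
          have e2 : q ^ x.1.card * q ^ x.2.card * (1 - q) ^ (X.card - (x.1.card + x.2.card)) *
              (p ^ x.2.card / q ^ x.2.card)
              = q ^ x.1.card * (1 - q) ^ (X.card - (x.1.card + x.2.card)) * p ^ x.2.card := by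
            field_simp
          rw [e2]
          have e3 : (1 - q) ^ x.2.card ≤ 1 := pow_le_one₀ (by linarith) (by linarith)
          have e4 := bern_weight_nonneg hq.le hq1 x.1.card (X.card - (x.1.card + x.2.card))
          have e5 : 0 ≤ p ^ x.2.card := pow_nonneg hp _
          nlinarith [mul_nonneg e4 e5]
      _ = ∑ y ∈ A.image (fun x => (⟨x.1 ∪ x.2, x.2⟩ : Σ _ : Finset α, Finset α)),
            w y.1 * (p / q) ^ y.2.card := by
          rw [Finset.sum_image]
          rintro ⟨W, T⟩ hx ⟨W', T'⟩ hx' heq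
          obtain ⟨hx1, hx2⟩ := mem_sigma.1 (mem_coe.1 hx)
          obtain ⟨hx1', hx2'⟩ := mem_sigma.1 (mem_coe.1 hx')
          obtain ⟨hd, -⟩ := key _ (mem_powerset.1 hx1) _ (mem_filter.1 hx2).1
          obtain ⟨hd', -⟩ := key _ (mem_powerset.1 hx1') _ (mem_filter.1 hx2').1
          simp only [Sigma.mk.injEq, heq_eq_eq] at heq hd hd' ⊢
          obtain ⟨h1, rfl⟩ := heq
          refine ⟨?_, rfl⟩
          rw [← union_sdiff_cancel_right hd, h1, union_sdiff_cancel_right hd']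
      _ ≤ ∑ y ∈ Bs, w y.1 * (p / q) ^ y.2.card := by
          refine Finset.sum_le_sum_of_subset_of_nonneg ?_ fun y _ _ =>
            mul_nonneg (bern_weight_nonneg hq.le hq1 _ _) (pow_nonneg (div_nonneg hp hq.le) _)
          intro y hy
          obtain ⟨x, hx, rfl⟩ := mem_image.1 hy
          obtain ⟨hx1, hx2⟩ := mem_sigma.1 hx
          obtain ⟨hd, hTX, hS, hTs⟩ := key _ (mem_powerset.1 hx1) _ (mem_filter.1 hx2).1
          refine mem_sigma.2 ⟨mem_powerset.2 (union_subset (mem_powerset.1 hx1) hTX), ?_⟩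
          dsimp only
          rw [if_pos hS]
          exact mem_filter.2 ⟨mem_powerset.2 hTs, (mem_filter.1 hx2).2⟩
  have step3 : ∑ y ∈ Bs, w y.1 * (p / q) ^ y.2.card ≤ bern q X (fun _ => D) := by
    rw [hBs, Finset.sum_sigma]
    refine Finset.sum_le_sum fun Z _ => ?_
    dsimp only
    rw [← Finset.mul_sum]
    refine mul_le_mul_of_nonneg_left ?_ (bern_weight_nonneg hq.le hq1 _ _)
    split_ifs with h
    · exact hD _ (hs Z h).1
    · simpa using hD0
  rw [step1]
  exact step2.trans (step3.trans_eq (bern_const _ _ _))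

lemma hasCover_round {X : Finset α} {p q r D e : ℝ} (hp : 0 ≤ p) (hq : 0 < q) (hq1 : q ≤ 1)
    (b : ℕ) (hr : 0 ≤ r) (hr1 : r ≤ 1) (hD0 : 0 ≤ D)
    (ih : ∀ F : Finset (Finset α), (∀ S ∈ F, S ⊆ X) → (∀ S ∈ F, S.card ≤ b) →
      HasCover p F (bern r X (upInd F) + e))
    (F : Finset (Finset α)) (hFX : ∀ S ∈ F, S ⊆ X)
    (hD : ∀ S ∈ F, ∑ T ∈ S.powerset with b < T.card, (p / q) ^ T.card ≤ D) :
    HasCover p F (bern (q + r - q * r) X (upInd F) + (D + e)) := by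
  set F' : Finset α → Finset (Finset α) := fun W => (minFrag F W).filter fun T => T.card ≤ b
  have hfr : ∀ W, ∀ T ∈ minFrag F W, ∃ S ∈ F, S \ W = T := fun W T hT =>
    mem_image.1 (mem_filter.1 hT).1
  have h1 : ∀ W, HasCover p F
      ((∑ T ∈ minFrag F W with b < T.card, p ^ T.card) + (bern r X (upInd (F' W)) + e)) := by
    intro W
    obtain ⟨U, hU, hUc⟩ := ih (F' W) (fun T hT => by
      obtain ⟨S, hS, rfl⟩ := hfr W T (mem_filter.1 hT).1
      exact sdiff_subset.trans (hFX S hS)) (fun T hT => (mem_filter.1 hT).2)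
    refine ⟨((minFrag F W).filter fun T => b < T.card) ∪ U, fun S hS => ?_, ?_⟩
    · obtain ⟨T, hT, hTS⟩ := exists_minFrag_subset W hS
      by_cases hb : b < T.card
      · exact ⟨T, mem_union_left _ (mem_filter.2 ⟨hT, hb⟩), hTS⟩
      · obtain ⟨T', h1, h2⟩ := hU T (mem_filter.2 ⟨hT, not_lt.1 hb⟩)
        exact ⟨T', mem_union_right _ h1, h2.trans hTS⟩
    · have := Finset.sum_union_inter (s₁ := (minFrag F W).filter fun T => b < T.card) (s₂ := U)
        (f := fun T => p ^ T.card)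
      have h0 : 0 ≤ ∑ T ∈ ((minFrag F W).filter fun T => b < T.card) ∩ U, p ^ T.card :=
        Finset.sum_nonneg fun T _ => pow_nonneg hp _
      linarith
  obtain ⟨W, -, hW⟩ := exists_le_bern hq.le hq1 X
    (fun W => (∑ T ∈ minFrag F W with b < T.card, p ^ T.card) + (bern r X (upInd (F' W)) + e))
  refine (h1 W).mono (hW.trans ?_)
  rw [bern_add, bern_add, bern_const]
  have h2 := bern_minFrag_le hFX hp hq hq1 b hD hD0
  have h3 : bern q X (fun W => bern r X (upInd (F' W))) ≤ bern (q + r - q * r) X (upInd F) := by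
    rw [← bern_union]
    refine bern_mono hq.le hq1 fun W _ => bern_mono hr hr1 fun W' _ => upInd_mono ?_
    rintro ⟨T, hT, hTW⟩
    obtain ⟨S, hS, rfl⟩ := hfr W T (mem_filter.1 hT).1
    exact ⟨S, hS, sdiff_le_iff.1 hTW⟩
  linarith

lemma hasCover_of_card_le {X : Finset α} {p L : ℝ} (hp : 0 < p) (hL : 0 < L) (B : ℕ) (hB : 1 ≤ B)
    (a : ℕ) (hle : (16 * a + L) * p ≤ 1)
    (F : Finset (Finset α)) (hFX : ∀ S ∈ F, S ⊆ X) (hF : ∀ S ∈ F, S.card ≤ 2 ^ a * B) :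
    HasCover p F (bern ((16 * a + L) * p) X (upInd F) +
      ((1 / 2) ^ B * (1 - (1 / 2) ^ a) + ((1 + 1 / L) ^ B - 1))) := by
  have hmono : ∀ F : Finset (Finset α), ∀ W W', upInd F W ≤ upInd F (W ∪ W') := fun F W W' =>
    upInd_mono fun ⟨S, hS, h⟩ => ⟨S, hS, h.trans subset_union_left⟩
  have hLB : (1 : ℝ) ≤ (1 + 1 / L) ^ B := one_le_pow₀ (by have := div_pos one_pos hL; linarith)
  induction a generalizing F with
  | zero =>
    have hLp : 0 < L * p := mul_pos hL hp
    have h0 : ∀ F : Finset (Finset α), (∀ S ∈ F, S ⊆ X) → (∀ S ∈ F, S.card ≤ 0) →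
        HasCover p F (bern 0 X (upInd F) + 0) := by
      intro F _ hF
      refine ⟨F, fun S hS => ⟨S, hS, Subset.rfl⟩, ?_⟩
      rw [bern_zero]
      have hF0 : F ⊆ {∅} := fun S hS => by simpa using hF S hS
      rcases Finset.subset_singleton_iff.1 hF0 with rfl | rfl <;> simp [upInd]
    have := hasCover_round (q := L * p) (D := (1 + 1 / L) ^ B - 1) hp.le hLp (by simpa using hle) 0
      le_rfl zero_le_one (by linarith) h0 F hFX (by
        intro S hS
        have e1 : p / (L * p) = 1 / L := by field_simp
        have h2 := Finset.sum_pow_mul_eq_add_pow (1 / L) 1 S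
        have h3 : ∑ T ∈ S.powerset, (1 / L) ^ T.card
            = 1 + ∑ T ∈ S.powerset with 0 < T.card, (1 / L) ^ T.card := by
          rw [← Finset.sum_filter_add_sum_filter_not S.powerset (fun T => 0 < T.card), add_comm]
          congr 1
          have : S.powerset.filter (fun T => ¬ 0 < T.card) = {∅} := by
            ext T
            simp only [mem_filter, mem_powerset, not_lt, Nat.le_zero, card_eq_zero, mem_singleton]
            exact ⟨fun h => h.2, fun h => ⟨h ▸ empty_subset _, h⟩⟩
          rw [this]; simp
        simp only [one_pow, mul_one] at h2
        rw [e1]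
        have h4 : (1 / L + 1) ^ S.card ≤ (1 + 1 / L) ^ B := by
          rw [add_comm]
          refine pow_le_pow_right₀ (by have := div_pos one_pos hL; linarith) ?_
          simpa using hF S hS
        linarith)
    simpa using this
  | succ a ih =>
    have ha0 : (0 : ℝ) ≤ a := Nat.cast_nonneg a
    push_cast at hle ⊢
    have hr1 : (16 * a + L) * p ≤ 1 := by nlinarith
    have hr0 : 0 ≤ (16 * a + L) * p := by positivity
    have h16 : 16 * p ≤ 1 := by nlinarith [mul_pos hL hp, mul_nonneg ha0 hp.le]
    have := hasCover_round (q := 16 * p) (D := (1 / 2) ^ (2 ^ (a + 1) * B)) hp.le (by positivity)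
      h16 (2 ^ a * B) hr0 hr1 (by positivity) (fun F h1 h2 => ih hr1 F h1 h2) F hFX (by
        intro S hS
        have e1 : p / (16 * p) = 1 / 16 := by field_simp
        rw [e1]
        calc ∑ T ∈ S.powerset with 2 ^ a * B < T.card, ((1 : ℝ) / 16) ^ T.card
            ≤ ∑ T ∈ S.powerset with 2 ^ a * B < T.card, ((1 : ℝ) / 16) ^ (2 ^ a * B) := by
              refine Finset.sum_le_sum fun T hT => ?_
              exact pow_le_pow_of_le_one (by norm_num) (by norm_num) (mem_filter.1 hT).2.le
          _ ≤ ∑ T ∈ S.powerset, ((1 : ℝ) / 16) ^ (2 ^ a * B) :=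
              Finset.sum_le_sum_of_subset_of_nonneg (filter_subset _ _)
                fun _ _ _ => by positivity
          _ = 2 ^ S.card * ((1 : ℝ) / 16) ^ (2 ^ a * B) := by
              rw [sum_const, card_powerset, nsmul_eq_mul]; push_cast; ring
          _ ≤ 2 ^ (2 ^ (a + 1) * B) * ((1 : ℝ) / 16) ^ (2 ^ a * B) := by
              gcongr
              · norm_num
              · exact hF S hS
          _ = (1 / 2) ^ (2 ^ (a + 1) * B) := by
              have e2 : 2 ^ (a + 1) * B = 2 * (2 ^ a * B) := by ring
              rw [e2, pow_mul 2 2, pow_mul (1 / 2 : ℝ) 2, ← mul_pow]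
              norm_num)
    refine this.mono ?_
    have h1 : bern (16 * p + (16 * a + L) * p - 16 * p * ((16 * a + L) * p)) X (upInd F)
        ≤ bern ((16 * (a + 1) + L) * p) X (upInd F) := by
      refine bern_mono_prob ?_ ?_ hle X (hmono F)
      · nlinarith
      · nlinarith [mul_nonneg (mul_nonneg (by norm_num : (0:ℝ) ≤ 16) hp.le) hr0]
    have h2 : ((1 : ℝ) / 2) ^ (2 ^ (a + 1) * B) ≤ (1 / 2) ^ (B + (a + 1)) := by
      refine pow_le_pow_of_le_one (by norm_num) (by norm_num) ?_
      have h3 : a + 1 < 2 ^ (a + 1) := Nat.lt_two_pow_self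
      nlinarith
    rw [pow_add _ B] at h2
    have h4 : ((1 : ℝ) / 2) ^ a = 2 * (1 / 2) ^ (a + 1) := by rw [pow_succ]; ring
    rw [h4]
    nlinarith

end Bernoulli

section Colouring

variable {E C : Type*}

lemma sum_fun_coord_average [Fintype E] [DecidableEq E] [Fintype C] (e : E) (F : C → (E → C) → ℝ)
    (hF : ∀ a c b, F a (Function.update c e b) = F a c) :
    (Fintype.card C : ℝ) * ∑ c : E → C, F (c e) c = ∑ a : C, ∑ c : E → C, F a c := by
  have h1 : ∑ x : C × (E → C), F x.1 x.2 = ∑ x : C × (E → C), F (x.2 e) x.2 := by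
    refine Fintype.sum_equiv
      (Function.Involutive.toPerm (fun x : C × (E → C) => (x.2 e, Function.update x.2 e x.1))
        fun x => by simp) _ _ fun x => ?_
    simp [Function.Involutive.toPerm, hF]
  rw [← Fintype.sum_prod_type', h1, Fintype.sum_prod_type]
  simp

/-- `f` gains from adding several pairs with the same first coordinate at most the sum of the
individual gains. -/
def FibreSubadditive [DecidableEq E] [DecidableEq C] (f : Finset (E × C) → ℝ) : Prop :=
  ∀ V e W, (∀ w ∈ W, w.1 = e) → f (V ∪ W) ≤ f V + ∑ w ∈ W, (f (insert w V) - f V)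

variable [DecidableEq E] [DecidableEq C]

lemma bern_linear {α : Type*} [DecidableEq α] (q : ℝ) (X : Finset α) (g : α → ℝ) :
    bern q X (fun W => ∑ w ∈ W, g w) = q * ∑ w ∈ X, g w := by
  induction X using Finset.induction_on with
  | empty => simp [bern_empty]
  | insert a X ha ih =>
    rw [bern_insert q ha, ih, sum_insert ha]
    have : bern q X (fun W => ∑ w ∈ insert a W, g w) = bern q X (fun W => g a + ∑ w ∈ W, g w) :=
      Finset.sum_congr rfl fun W hW => by
        dsimp only
        rw [sum_insert fun h => ha (mem_powerset.1 hW h)]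
    rw [this, bern_add, bern_const, ih]
    ring

lemma bern_pairs_le_bern_colouring [Fintype E] [Fintype C] [Nonempty C] {p : ℝ} (hp0 : 0 ≤ p)
    (hp1 : p ≤ 1) (H : Finset E) (f : Finset (E × C) → ℝ) (hf : FibreSubadditive f) :
    bern (p / Fintype.card C) (H ×ˢ (univ : Finset C)) f ≤
      bern p H (fun R => ((Fintype.card C : ℝ) ^ Fintype.card E)⁻¹ *
        ∑ c : E → C, f (R.image fun e => (e, c e))) := by
  have hC : (1 : ℝ) ≤ Fintype.card C := by exact_mod_cast Fintype.card_pos (α := C)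
  have hC0 : (0 : ℝ) < Fintype.card C := by linarith
  have hr0 : 0 ≤ p / Fintype.card C := div_nonneg hp0 hC0.le
  have hr1 : p / Fintype.card C ≤ 1 := by rw [div_le_one hC0]; linarith
  induction H using Finset.induction_on generalizing f with
  | empty =>
    simp only [empty_product, bern_empty, image_empty, sum_const, card_univ, Fintype.card_fun,
      nsmul_eq_mul]
    push_cast
    rw [inv_mul_cancel_left₀ (pow_pos hC0 _).ne']
  | insert e H he ih =>
    set N : ℝ := (Fintype.card C : ℝ) ^ Fintype.card E with hN
    have hN0 : 0 < N := pow_pos hC0 _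
    have hY : (insert e H) ×ˢ (univ : Finset C)
        = (H ×ˢ (univ : Finset C)) ∪ (({e} : Finset E) ×ˢ (univ : Finset C)) := by
      rw [← union_product, union_comm, Finset.insert_eq]
    have hdis : Disjoint (H ×ˢ (univ : Finset C)) (({e} : Finset E) ×ˢ (univ : Finset C)) := by
      rw [disjoint_product]
      left
      simpa using he
    have hstep : ∀ V, bern (p / Fintype.card C) (({e} : Finset E) ×ˢ (univ : Finset C))
        (fun W => f (V ∪ W)) ≤
        (1 - p) * f V + p / Fintype.card C * ∑ a : C, f (insert (e, a) V) := by
      intro V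
      calc _ ≤ bern (p / Fintype.card C) (({e} : Finset E) ×ˢ (univ : Finset C))
              (fun W => f V + ∑ w ∈ W, (f (insert w V) - f V)) := by
            refine bern_mono hr0 hr1 fun W hW => hf V e W fun w hw => ?_
            simpa using (mem_product.1 (hW hw)).1
        _ = (1 - p) * f V + p / Fintype.card C * ∑ a : C, f (insert (e, a) V) := by
            rw [bern_add, bern_const, bern_linear, singleton_product, sum_map]
            simp only [Function.Embedding.coeFn_mk, sum_sub_distrib, sum_const, card_univ,
              nsmul_eq_mul]
            field_simp
            ring
    have hsub : ∀ W0, FibreSubadditive fun V => f (W0 ∪ V) := by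
      intro W0 V e' W hW
      have := hf (W0 ∪ V) e' W hW
      simpa only [union_assoc, union_insert] using this
    rw [hY, bern_disjoint_union _ _ _ hdis]
    have hsubi : ∀ a, FibreSubadditive fun V => f (insert (e, a) V) := by
      intro a
      have := hsub {(e, a)}
      simpa only [← Finset.insert_eq] using this
    calc _ ≤ bern (p / Fintype.card C) (H ×ˢ (univ : Finset C)) (fun V =>
              (1 - p) * f V + p / Fintype.card C * ∑ a : C, f (insert (e, a) V)) :=
          bern_mono hr0 hr1 fun V _ => hstep V
      _ = (1 - p) * bern (p / Fintype.card C) (H ×ˢ (univ : Finset C)) f + p / Fintype.card C *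
          ∑ a : C, bern (p / Fintype.card C) (H ×ˢ (univ : Finset C))
            (fun V => f (insert (e, a) V)) := by
          rw [bern_add, bern_mul, bern_mul, bern_sum]
      _ ≤ (1 - p) * bern p H (fun R => N⁻¹ * ∑ c : E → C, f (R.image fun e => (e, c e))) +
          p / Fintype.card C * ∑ a : C, bern p H (fun R => N⁻¹ *
            ∑ c : E → C, f (insert (e, a) (R.image fun e => (e, c e)))) := by
          refine add_le_add (mul_le_mul_of_nonneg_left (ih f hf) (by linarith))
            (mul_le_mul_of_nonneg_left (sum_le_sum fun a _ => ih _ (hsubi a)) hr0)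
      _ = bern p (insert e H) (fun R => N⁻¹ *
            ∑ c : E → C, f (R.image fun e => (e, c e))) := by
          rw [bern_insert p he]
          congr 1
          rw [← bern_sum, div_eq_mul_inv, mul_assoc, ← bern_mul]
          congr 1
          refine Finset.sum_congr rfl fun R hR => ?_
          dsimp only
          congr 1
          rw [← mul_sum, mul_left_comm]
          congr 1
          rw [inv_mul_eq_iff_eq_mul₀ hC0.ne']
          simp only [image_insert]
          rw [sum_fun_coord_average e
            (fun a c => f (insert (e, a) (R.image fun e => (e, c e))))]
          intro a c b
          congr 2
          refine image_congr fun e' he' => ?_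
          have : e' ≠ e := fun h => he (h ▸ mem_powerset.1 hR he')
          simp [this]

lemma fibreSubadditive_upInd (F : Finset (Finset (E × C)))
    (hF : ∀ S ∈ F, ∀ x ∈ S, ∀ y ∈ S, x.1 = y.1 → x = y) : FibreSubadditive (upInd F) := by
  intro V e W hW
  have hmono : ∀ w, upInd F V ≤ upInd F (insert w V) := fun w =>
    upInd_mono fun ⟨S, hS, h⟩ => ⟨S, hS, h.trans (subset_insert _ _)⟩
  have hsum : 0 ≤ ∑ w ∈ W, (upInd F (insert w V) - upInd F V) :=
    sum_nonneg fun w _ => sub_nonneg.2 (hmono w)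
  by_cases hV : ∃ S ∈ F, S ⊆ V
  · have h1 : upInd F V = 1 := if_pos hV
    have h2 : upInd F (V ∪ W) ≤ 1 := by unfold upInd; split_ifs <;> norm_num
    linarith
  by_cases hVW : ∃ S ∈ F, S ⊆ V ∪ W
  · obtain ⟨S, hS, hSVW⟩ := hVW
    have : ∃ w ∈ S, w ∉ V := by
      by_contra! h
      exact hV ⟨S, hS, h⟩
    obtain ⟨w, hwS, hwV⟩ := this
    have hwW : w ∈ W := (mem_union.1 (hSVW hwS)).resolve_left hwV
    have h1 : upInd F (insert w V) = 1 := if_pos ⟨S, hS, fun x hx => by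
      rcases mem_union.1 (hSVW hx) with h | h
      · exact mem_insert_of_mem h
      · rw [hF S hS x hx w hwS ((hW x h).trans (hW w hwW).symm)]
        exact mem_insert_self _ _⟩
    have h2 : upInd F (V ∪ W) = 1 := if_pos ⟨S, hS, hSVW⟩
    have h3 : upInd F (insert w V) - upInd F V ≤ ∑ w ∈ W, (upInd F (insert w V) - upInd F V) :=
      single_le_sum (f := fun w => upInd F (insert w V) - upInd F V)
        (fun w _ => sub_nonneg.2 (hmono w)) hwW
    linarith
  · have h1 : upInd F V = 0 := if_neg hV
    have h2 : upInd F (V ∪ W) = 0 := if_neg hVW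
    linarith

end Colouring

section LocalLemma

variable {Ω ι : Type*} [Fintype Ω]

/-- The outcomes lying in none of the events `A i`, `i ∈ S`. -/
noncomputable def avoiding (A : ι → Finset Ω) (S : Finset ι) : Finset Ω :=
  univ.filter fun ω => ∀ i ∈ S, ω ∉ A i

lemma mem_avoiding {A : ι → Finset Ω} {S : Finset ι} {ω : Ω} :
    ω ∈ avoiding A S ↔ ∀ i ∈ S, ω ∉ A i := by
  simp [avoiding]

lemma avoiding_anti (A : ι → Finset Ω) {S T : Finset ι} (h : S ⊆ T) :
    avoiding A T ⊆ avoiding A S := fun _ hω =>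
  mem_avoiding.2 fun i hi => mem_avoiding.1 hω i (h hi)

variable [DecidableEq Ω] [DecidableEq ι]

lemma card_avoiding_le (A : ι → Finset Ω) (S T : Finset ι) :
    (avoiding A S).card ≤ (avoiding A (S ∪ T)).card + ∑ j ∈ T, (A j ∩ avoiding A S).card := by
  have : avoiding A S ⊆ avoiding A (S ∪ T) ∪ T.biUnion fun j => A j ∩ avoiding A S := by
    intro ω hω
    by_cases h : ω ∈ avoiding A (S ∪ T)
    · exact mem_union_left _ h
    · refine mem_union_right _ (mem_biUnion.2 ?_)
      simp only [avoiding, mem_filter, mem_univ, true_and, not_forall, mem_union] at h hω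
      obtain ⟨i, hi, hiω⟩ := h
      rcases hi with hi | hi
      · exact absurd (hω i hi) hiω
      · exact ⟨i, hi, mem_inter.2 ⟨not_not.1 hiω, by simpa [avoiding] using hω⟩⟩
  exact (card_le_card this).trans ((card_union_le _ _).trans (by gcongr; exact card_biUnion_le))

/-- A lopsided form of the Lovász local lemma: the conditional probability of an event given
that other events are avoided is at most twice its probability. -/
lemma local_lemma (A : ι → Finset Ω) (adj : ι → ι → Prop) [DecidableRel adj] (I : Finset ι)
    (hlop : ∀ i ∈ I, ∀ S ⊆ I, (∀ j ∈ S, ¬ adj i j) →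
      (A i ∩ avoiding A S).card * Fintype.card Ω ≤ (A i).card * (avoiding A S).card)
    (hsum : ∀ i ∈ I, ∑ j ∈ I with adj i j, 4 * (A j).card ≤ Fintype.card Ω)
    (S : Finset ι) (hS : S ⊆ I) (i : ι) (hi : i ∈ I) :
    (A i ∩ avoiding A S).card * Fintype.card Ω ≤ 2 * (A i).card * (avoiding A S).card := by
  induction hn : S.card using Nat.strong_induction_on generalizing S i with
  | _ n ih =>
    set S₂ := S.filter fun j => ¬ adj i j
    set S₁ := S.filter fun j => adj i j
    have hS₂ : S₂ ⊆ I := (filter_subset _ _).trans hS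
    have h1 : (A i ∩ avoiding A S).card * Fintype.card Ω ≤ (A i).card * (avoiding A S₂).card :=
      (Nat.mul_le_mul_right _ (card_le_card
        (inter_subset_inter_left (avoiding_anti A (filter_subset _ _))))).trans
        (hlop i hi S₂ hS₂ fun j hj => (mem_filter.1 hj).2)
    have hU : S₂ ∪ S₁ = S := by rw [union_comm]; exact filter_union_filter_not_eq _ _
    have h2 : (avoiding A S₂).card ≤ 2 * (avoiding A S).card := by
      rcases S₁.eq_empty_or_nonempty with h | h
      · rw [h, union_empty] at hU
        rw [hU]; omega
      · have hlt : S₂.card < n := by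
          rw [← hn]
          refine card_lt_card (filter_ssubset.2 ?_)
          obtain ⟨j, hj⟩ := h
          exact ⟨j, (mem_filter.1 hj).1, not_not.2 (mem_filter.1 hj).2⟩
        have h3 := card_avoiding_le A S₂ S₁
        rw [hU] at h3
        have h4 : ∀ j ∈ S₁, (A j ∩ avoiding A S₂).card * Fintype.card Ω ≤
            2 * (A j).card * (avoiding A S₂).card := fun j hj =>
          ih _ hlt S₂ hS₂ j (hS (mem_filter.1 hj).1) rfl
        have h5 := sum_le_sum h4
        rw [← sum_mul, ← sum_mul, ← mul_sum] at h5
        have h6 : ∑ j ∈ S₁, 4 * (A j).card ≤ Fintype.card Ω :=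
          (sum_le_sum_of_subset (filter_subset_filter _ hS)).trans (hsum i hi)
        rw [← mul_sum] at h6
        rcases Nat.eq_zero_or_pos (Fintype.card Ω) with h0 | h0
        · have := card_le_univ (avoiding A S₂)
          omega
        · refine Nat.le_of_mul_le_mul_right (c := Fintype.card Ω) ?_ h0
          nlinarith
    nlinarith

lemma exp_neg_two_mul_le {y : ℝ} (h0 : 0 ≤ y) (h1 : y ≤ 1 / 2) : Real.exp (-(2 * y)) ≤ 1 - y := by
  rw [Real.exp_neg]
  have h2 : 1 + 2 * y ≤ Real.exp (2 * y) := by linarith [Real.add_one_le_exp (2 * y)]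
  rw [inv_le_comm₀ (Real.exp_pos _) (by linarith)]
  refine le_trans ?_ h2
  rw [inv_le_comm₀ (by linarith) (by linarith), inv_le_iff_one_le_mul₀ (by linarith)]
  nlinarith

lemma card_avoiding_ge (A : ι → Finset Ω) (adj : ι → ι → Prop) [DecidableRel adj] (I : Finset ι)
    (hlop : ∀ i ∈ I, ∀ S ⊆ I, (∀ j ∈ S, ¬ adj i j) →
      (A i ∩ avoiding A S).card * Fintype.card Ω ≤ (A i).card * (avoiding A S).card)
    (hsum : ∀ i ∈ I, ∑ j ∈ I with adj i j, 4 * (A j).card ≤ Fintype.card Ω)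
    (hrefl : ∀ i ∈ I, adj i i) (hΩ : 0 < Fintype.card Ω) (S T : Finset ι) (hS : S ⊆ I)
    (hT : T ⊆ I) :
    (avoiding A S).card * Real.exp (-((∑ j ∈ T, 4 * ((A j).card : ℝ)) / Fintype.card Ω)) ≤
      ((avoiding A (S ∪ T)).card : ℝ) := by
  have hΩ' : (0 : ℝ) < Fintype.card Ω := by exact_mod_cast hΩ
  induction T using Finset.induction_on with
  | empty => simp
  | insert j T hj ih =>
    have hjI : j ∈ I := hT (mem_insert_self _ _)
    have hT' : T ⊆ I := (subset_insert _ _).trans hT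
    have h1 := card_avoiding_le A (S ∪ T) {j}
    have h2 := local_lemma A adj I hlop hsum (S ∪ T) (union_subset hS hT') j hjI
    have h3 : 4 * (A j).card ≤ Fintype.card Ω :=
      (single_le_sum (f := fun j => 4 * (A j).card) (fun _ _ => Nat.zero_le _)
        (mem_filter.2 ⟨hjI, hrefl j hjI⟩)).trans (hsum j hjI)
    rw [sum_singleton, union_assoc, union_comm T, ← insert_eq] at h1
    have h1' : ((avoiding A (S ∪ T)).card : ℝ) ≤ (avoiding A (S ∪ insert j T)).card +
      (A j ∩ avoiding A (S ∪ T)).card := by exact_mod_cast h1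
    have h2' : ((A j ∩ avoiding A (S ∪ T)).card : ℝ) * Fintype.card Ω ≤
      2 * (A j).card * (avoiding A (S ∪ T)).card := by exact_mod_cast h2
    have h3' : 4 * ((A j).card : ℝ) ≤ Fintype.card Ω := by exact_mod_cast h3
    have h4 := exp_neg_two_mul_le (y := 2 * (A j).card / Fintype.card Ω) (by positivity)
      (by rw [div_le_iff₀ hΩ']; linarith)
    rw [← le_div_iff₀ hΩ'] at h2'
    rw [sum_insert hj, add_div, neg_add, Real.exp_add, mul_left_comm]
    have h5 : 2 * (2 * ((A j).card : ℝ) / Fintype.card Ω) = 4 * (A j).card / Fintype.card Ω := by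
      ring
    rw [h5] at h4
    calc Real.exp (-(4 * ((A j).card : ℝ) / Fintype.card Ω)) * _
        ≤ (1 - 2 * (A j).card / Fintype.card Ω) * (avoiding A (S ∪ T)).card := by
          refine mul_le_mul h4 (ih hT') (by positivity) ?_
          exact (Real.exp_pos _).le.trans h4
      _ = (avoiding A (S ∪ T)).card -
          2 * (A j).card * (avoiding A (S ∪ T)).card / Fintype.card Ω := by ring
      _ ≤ _ := by linarith

end LocalLemma

section Permutations

variable {V : Type*} [DecidableEq V]

lemma exists_perm_extending (ρ : Equiv.Perm V) (Y : Finset V) :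
    ∃ τ : Equiv.Perm V, (∀ v ∈ Y, τ v = ρ v) ∧ ∀ v, v ∉ Y → (∀ y ∈ Y, v ≠ ρ y) → τ v = v := by
  induction Y using Finset.induction_on with
  | empty => exact ⟨1, by simp, by simp⟩
  | insert a Y ha ih =>
    obtain ⟨τ, h1, h2⟩ := ih
    refine ⟨Equiv.swap (τ a) (ρ a) * τ, fun v hv => ?_, fun v hv hv' => ?_⟩
    · rcases mem_insert.1 hv with rfl | hv
      · simp
      · have hne : v ≠ a := fun h => ha (h ▸ hv)
        rw [Equiv.Perm.mul_apply, Equiv.swap_apply_of_ne_of_ne (τ.injective.ne hne), h1 v hv]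
        rw [h1 v hv]; exact ρ.injective.ne hne
    · rw [mem_insert, not_or] at hv
      have h3 := h2 v hv.2 fun y hy => hv' y (mem_insert_of_mem hy)
      rw [Equiv.Perm.mul_apply, Equiv.swap_apply_of_ne_of_ne (τ.injective.ne hv.1), h3]
      rw [h3]; exact hv' a (mem_insert_self _ _)

variable [Fintype V]

/-- The permutations `π` with `π p = v` for all `(p, v) ∈ M`. -/
def extending (M : Finset (V × V)) : Finset (Equiv.Perm V) :=
  univ.filter fun π => ∀ x ∈ M, π x.1 = x.2

lemma mem_extending {M : Finset (V × V)} {π : Equiv.Perm V} :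
    π ∈ extending M ↔ ∀ x ∈ M, π x.1 = x.2 := by
  simp [extending]

/-- Two partial assignments meet if they share a position or a value. -/
def Meets (M M' : Finset (V × V)) : Prop :=
  (∃ x ∈ M, ∃ y ∈ M', x.1 = y.1) ∨ ∃ x ∈ M, ∃ y ∈ M', x.2 = y.2

lemma card_extending_inter_le (M : Finset (V × V)) (S : Finset (Finset (V × V)))
    (hS : ∀ M' ∈ S, ¬ Meets M M') :
    (extending M ∩ avoiding extending S).card * Fintype.card (Equiv.Perm V) ≤
      (extending M).card * (avoiding extending S).card := by
  have hinj : ∀ ρ : Equiv.Perm V, (extending M ∩ avoiding extending S).card ≤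
      ((avoiding extending S).filter fun π => ∀ x ∈ M, π x.1 = ρ x.2).card := by
    intro ρ
    obtain ⟨τ, h1, h2⟩ := exists_perm_extending ρ (M.image Prod.snd)
    refine card_le_card_of_injOn (fun π => τ * π) (fun π hπ => ?_) (mul_right_injective τ).injOn
    obtain ⟨hπM, hπS⟩ := mem_inter.1 (mem_coe.1 hπ)
    rw [mem_extending] at hπM
    have hπS' := mem_avoiding.1 hπS
    have h3 : ∀ x ∈ M, τ (π x.1) = ρ x.2 := fun x hx => by
      rw [hπM x hx, h1 _ (mem_image_of_mem _ hx)]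
    refine mem_coe.2 (mem_filter.2 ⟨mem_avoiding.2 fun M' hM' hmem => ?_, h3⟩)
    refine hπS' M' hM' (mem_extending.2 fun y hy => ?_)
    have h4 : τ (π y.1) = y.2 := mem_extending.1 hmem y hy
    have h5 := hS M' hM'
    simp only [Meets, not_or, not_exists, not_and] at h5
    have h6 : τ y.2 = y.2 := by
      refine h2 _ (fun hmem => ?_) fun v hv heq => ?_
      · obtain ⟨x, hx, hxy⟩ := mem_image.1 hmem
        exact h5.2 x hx y hy hxy
      · obtain ⟨x, hx, rfl⟩ := mem_image.1 hv
        rw [← h3 x hx, ← h4] at heq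
        exact h5.1 x hx y hy (π.injective (τ.injective heq)).symm
    exact τ.injective (h4.trans h6.symm)
  have hcount : ∀ π : Equiv.Perm V,
      (univ.filter fun ρ : Equiv.Perm V => ∀ x ∈ M, π x.1 = ρ x.2).card = (extending M).card := by
    intro π
    refine card_bij' (fun ρ _ => ρ⁻¹ * π) (fun σ _ => π * σ⁻¹) (fun ρ hρ => ?_) (fun σ hσ => ?_)
      (fun ρ _ => by simp) (fun σ _ => by simp)
    · refine mem_extending.2 fun x hx => ?_
      rw [Equiv.Perm.mul_apply, (mem_filter.1 hρ).2 x hx, Equiv.Perm.coe_inv, Equiv.symm_apply_apply]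
    · refine mem_filter.2 ⟨mem_univ _, fun x hx => ?_⟩
      rw [Equiv.Perm.mul_apply, ← mem_extending.1 hσ x hx, Equiv.Perm.coe_inv, Equiv.symm_apply_apply]
  calc (extending M ∩ avoiding extending S).card * Fintype.card (Equiv.Perm V)
      = ∑ _ρ : Equiv.Perm V, (extending M ∩ avoiding extending S).card := by
        rw [sum_const, card_univ, smul_eq_mul, mul_comm]
    _ ≤ ∑ ρ : Equiv.Perm V,
          ((avoiding extending S).filter fun π => ∀ x ∈ M, π x.1 = ρ x.2).card :=
        sum_le_sum fun ρ _ => hinj ρ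
    _ = ∑ π ∈ avoiding extending S,
          (univ.filter fun ρ : Equiv.Perm V => ∀ x ∈ M, π x.1 = ρ x.2).card :=
        (sum_card_bipartiteAbove_eq_sum_card_bipartiteBelow
          (fun π ρ : Equiv.Perm V => ∀ x ∈ M, π x.1 = ρ x.2)).symm
    _ = (extending M).card * (avoiding extending S).card := by
        rw [sum_congr rfl fun π _ => hcount π, sum_const, smul_eq_mul, mul_comm]

lemma card_extending {M : Finset (V × V)} (h : (extending M).Nonempty) :
    (extending M).card = (Fintype.card V - M.card).factorial := by
  obtain ⟨π, hπ⟩ := h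
  rw [mem_extending] at hπ
  have hinj : Set.InjOn Prod.snd (M : Set (V × V)) := fun x hx y hy hxy =>
    Prod.ext (π.injective (by rw [hπ x hx, hπ y hy, hxy])) hxy
  have h1 : (extending M).card
      = Fintype.card {f : Equiv.Perm V // ∀ a, ¬ (a ∉ M.image Prod.snd) → f a = a} := by
    rw [Fintype.card_subtype]
    refine card_bij' (fun σ _ => σ * π⁻¹) (fun f _ => f * π) (fun σ hσ => ?_) (fun f hf => ?_)
      (fun σ _ => by simp) (fun f _ => by simp)
    · refine mem_filter.2 ⟨mem_univ _, fun a ha => ?_⟩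
      obtain ⟨x, hx, rfl⟩ := mem_image.1 (not_not.1 ha)
      rw [Equiv.Perm.mul_apply, ← hπ x hx, Equiv.Perm.coe_inv, Equiv.symm_apply_apply, mem_extending.1 hσ x hx,
        hπ x hx]
    · refine mem_extending.2 fun x hx => ?_
      rw [Equiv.Perm.mul_apply, hπ x hx]
      exact (mem_filter.1 hf).2 _ (not_not.2 (mem_image_of_mem _ hx))
  rw [h1, ← Fintype.card_congr (Equiv.Perm.subtypeEquivSubtypePerm fun a => a ∉ M.image Prod.snd),
    Fintype.card_perm, Fintype.card_subtype_compl, Fintype.card_coe, card_image_of_injOn hinj]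

lemma pow_le_exp_mul_descFactorial (n m : ℕ) (h : m ≤ n) :
    (n : ℝ) ^ m ≤ Real.exp 1 ^ m * n.descFactorial m := by
  induction m generalizing n with
  | zero => simp
  | succ m ih =>
    obtain ⟨n, rfl⟩ : ∃ n', n = n' + 1 := ⟨n - 1, by omega⟩
    have h1 := ih n (by omega)
    rw [Nat.succ_descFactorial_succ]
    push_cast
    have h2 : ((n : ℝ) + 1) ^ m ≤ Real.exp 1 * (n : ℝ) ^ m := by
      rcases Nat.eq_zero_or_pos n with rfl | hn
      · have : m = 0 := by omega
        subst this
        simp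
      · have hn' : (0 : ℝ) < n := by exact_mod_cast hn
        have h3 : (n : ℝ) + 1 = (1 + 1 / n) * n := by field_simp
        rw [h3, mul_pow]
        refine mul_le_mul_of_nonneg_right ?_ (by positivity)
        have h4 : 1 + 1 / (n : ℝ) ≤ Real.exp (1 / n) := by
          linarith [Real.add_one_le_exp (1 / (n : ℝ))]
        calc (1 + 1 / (n : ℝ)) ^ m ≤ Real.exp (1 / n) ^ m := by gcongr
          _ = Real.exp (m / n) := by rw [← Real.exp_nat_mul]; ring_nf
          _ ≤ Real.exp 1 := by
            rw [Real.exp_le_exp, div_le_one hn']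
            exact_mod_cast (by omega : m ≤ n)
    calc ((n : ℝ) + 1) ^ (m + 1) = ((n : ℝ) + 1) ^ m * (n + 1) := pow_succ _ _
      _ ≤ (Real.exp 1 * (Real.exp 1 ^ m * n.descFactorial m)) * (n + 1) := by
        refine mul_le_mul_of_nonneg_right (h2.trans ?_) (by positivity)
        exact mul_le_mul_of_nonneg_left h1 (Real.exp_pos _).le
      _ = _ := by ring

lemma card_extending_mul_pow_le (M : Finset (V × V)) :
    ((extending M).card : ℝ) * (Fintype.card V : ℝ) ^ M.card ≤
      Real.exp 1 ^ M.card * (Fintype.card (Equiv.Perm V) : ℝ) := by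
  rcases (extending M).eq_empty_or_nonempty with h | h
  · rw [h]
    simp only [card_empty, Nat.cast_zero, zero_mul]
    positivity
  · have hM : M.card ≤ Fintype.card V := by
      obtain ⟨π, hπ⟩ := h
      rw [mem_extending] at hπ
      refine card_le_card_of_injOn Prod.snd (fun _ _ => mem_coe.2 (mem_univ _))
        fun x hx y hy hxy => Prod.ext (π.injective (by rw [hπ x hx, hπ y hy, hxy])) hxy
    rw [card_extending h, Fintype.card_perm, ← Nat.factorial_mul_descFactorial hM]
    push_cast
    have := pow_le_exp_mul_descFactorial _ _ hM
    have h0 : (0 : ℝ) ≤ ((Fintype.card V - M.card).factorial : ℝ) := by positivity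
    nlinarith [mul_le_mul_of_nonneg_left this h0]

end Permutations

lemma sum_union_le {α : Type*} [DecidableEq α] (S T : Finset α) (f : α → ℕ) :
    ∑ x ∈ S ∪ T, f x ≤ ∑ x ∈ S, f x + ∑ x ∈ T, f x := by
  rw [← sum_union_inter]
  exact Nat.le_add_right _ _

lemma sum_biUnion_le {ι α : Type*} [DecidableEq ι] [DecidableEq α] (S : Finset ι)
    (t : ι → Finset α) (f : α → ℕ) :
    ∑ x ∈ S.biUnion t, f x ≤ ∑ i ∈ S, ∑ x ∈ t i, f x := by
  induction S using Finset.induction_on with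
  | empty => simp
  | insert a S ha ih =>
    rw [biUnion_insert, sum_insert ha]
    exact (sum_union_le _ _ _).trans (Nat.add_le_add_left ih _)

section SpreadPermutations

variable {V J : Type*} [Fintype V] [DecidableEq V] [DecidableEq J]

/-- The restriction of the permutation `π` to the block with label `j`, as a set of pairs. -/
noncomputable def blockGraph (blk : V → J) (π : Equiv.Perm V) (j : J) : Finset (V × V) :=
  univ.filter fun x => blk x.1 = j ∧ π x.1 = x.2

lemma mem_blockGraph {blk : V → J} {π : Equiv.Perm V} {j : J} {x : V × V} :
    x ∈ blockGraph blk π j ↔ blk x.1 = j ∧ π x.1 = x.2 := by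
  simp [blockGraph]

lemma blockGraph_eq_of_mem_extending {blk : V → J} {π π' : Equiv.Perm V} {j : J}
    (h : π' ∈ extending (blockGraph blk π j)) : blockGraph blk π j = blockGraph blk π' j := by
  rw [mem_extending] at h
  have h' : ∀ q, blk q = j → π' q = π q := fun q hq =>
    h (q, π q) (mem_blockGraph.2 ⟨hq, rfl⟩)
  ext x
  simp only [mem_blockGraph]
  exact and_congr_right fun hx => by rw [h' _ hx]

/-- The restrictions of permutations to blocks on which they are bad. -/
noncomputable def badGraphs (blk : V → J) (bad : J → Equiv.Perm V → Prop) :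
    Finset (Finset (V × V)) :=
  univ.filter fun M => ∃ (p : V) (π : Equiv.Perm V), bad (blk p) π ∧ M = blockGraph blk π (blk p)

lemma sum_card_extending_le (blk : V → J) (bad : J → Equiv.Perm V → Prop)
    (hbad : ∀ j π π', (∀ q, blk q = j → π q = π' q) → bad j π → bad j π')
    (f : Equiv.Perm V → V) (A : Finset (Finset (V × V))) (hA : A ⊆ badGraphs blk bad)
    (hf : ∀ M ∈ A, ∀ π ∈ extending M, ∃ x ∈ M, x.1 = f π) :
    ∑ M ∈ A, (extending M).card ≤ (univ.filter fun π => bad (blk (f π)) π).card := by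
  rw [← card_sigma]
  have key : ∀ M ∈ A, ∀ π ∈ extending M,
      bad (blk (f π)) π ∧ M = blockGraph blk π (blk (f π)) := by
    intro M hM π hπ
    obtain ⟨p, ρ, hρ, rfl⟩ := (mem_filter.1 (hA hM)).2
    obtain ⟨x, hx, hxf⟩ := hf _ hM π hπ
    have h1 : blk (f π) = blk p := by rw [← hxf, (mem_blockGraph.1 hx).1]
    rw [h1]
    refine ⟨hbad _ ρ π (fun q hq => ?_) hρ, blockGraph_eq_of_mem_extending hπ⟩
    exact ((mem_extending.1 hπ) (q, ρ q) (mem_blockGraph.2 ⟨hq, rfl⟩)).symm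
  refine card_le_card_of_injOn (fun y => y.2) (fun y hy => ?_) fun y hy z hz hyz => ?_
  · obtain ⟨h1, h2⟩ := mem_sigma.1 (mem_coe.1 hy)
    exact mem_coe.2 (mem_filter.2 ⟨mem_univ _, (key _ h1 _ h2).1⟩)
  · obtain ⟨h1, h2⟩ := mem_sigma.1 (mem_coe.1 hy)
    obtain ⟨h3, h4⟩ := mem_sigma.1 (mem_coe.1 hz)
    dsimp only at hyz
    have h5 := (key _ h1 _ h2).2
    have h6 := (key _ h3 _ h4).2
    rw [hyz, ← h6] at h5
    exact Sigma.ext h5 (heq_of_eq hyz)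

lemma sum_card_meets_le (blk : V → J) (w : ℕ) (bad : J → Equiv.Perm V → Prop)
    (hbad : ∀ j π π', (∀ q, blk q = j → π q = π' q) → bad j π → bad j π')
    (hconc : ∀ p v, 16 * w * Fintype.card V *
      (univ.filter fun π : Equiv.Perm V => π p = v ∧ bad (blk p) π).card ≤
        Fintype.card (Equiv.Perm V)) (M : Finset (V × V)) :
    8 * w * ∑ M' ∈ badGraphs blk bad with Meets M M', (extending M').card ≤
      M.card * Fintype.card (Equiv.Perm V) := by
  have hV : ∀ x : V, 0 < Fintype.card V := fun x => Fintype.card_pos_iff.2 ⟨x⟩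
  have h1 : ∀ p : V, 16 * w * (univ.filter fun π : Equiv.Perm V => bad (blk p) π).card ≤
      Fintype.card (Equiv.Perm V) := by
    intro p
    refine Nat.le_of_mul_le_mul_left ?_ (hV p)
    rw [card_eq_sum_card_fiberwise (f := fun π : Equiv.Perm V => π p) (t := univ)
      (fun _ _ => mem_coe.2 (mem_univ _)), mul_sum, mul_sum]
    refine (sum_le_card_nsmul univ _ (Fintype.card (Equiv.Perm V)) fun v _ => ?_).trans
      (by rw [card_univ, smul_eq_mul])
    refine le_trans (le_of_eq ?_) (hconc p v)
    rw [filter_filter]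
    simp only [and_comm]
    ring
  have h2 : ∀ v : V, 16 * w *
      (univ.filter fun π : Equiv.Perm V => bad (blk (π.symm v)) π).card ≤
      Fintype.card (Equiv.Perm V) := by
    intro v
    refine Nat.le_of_mul_le_mul_left ?_ (hV v)
    rw [card_eq_sum_card_fiberwise (f := fun π : Equiv.Perm V => π.symm v) (t := univ)
      (fun _ _ => mem_coe.2 (mem_univ _)), mul_sum, mul_sum]
    refine (sum_le_card_nsmul univ _ (Fintype.card (Equiv.Perm V)) fun p _ => ?_).trans
      (by rw [card_univ, smul_eq_mul])
    refine le_trans (le_of_eq ?_) (hconc p v)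
    rw [filter_filter]
    have : (univ.filter fun π : Equiv.Perm V => bad (blk (π.symm v)) π ∧ π.symm v = p) =
        univ.filter fun π : Equiv.Perm V => π p = v ∧ bad (blk p) π := by
      refine filter_congr fun π _ => ?_
      rw [Equiv.symm_apply_eq]
      constructor
      · rintro ⟨h, rfl⟩
        exact ⟨rfl, by simpa using h⟩
      · rintro ⟨rfl, h⟩
        exact ⟨by simpa using h, rfl⟩
    rw [this]
    ring
  have h3 : ∑ M' ∈ badGraphs blk bad with Meets M M', (extending M').card ≤
      ∑ x ∈ M, ((univ.filter fun π : Equiv.Perm V => bad (blk x.1) π).card +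
        (univ.filter fun π : Equiv.Perm V => bad (blk (π.symm x.2)) π).card) := by
    have hsub : (badGraphs blk bad).filter (Meets M) ⊆
        M.biUnion fun x => ((badGraphs blk bad).filter fun M' => ∃ y ∈ M', y.1 = x.1) ∪
          (badGraphs blk bad).filter fun M' => ∃ y ∈ M', y.2 = x.2 := by
      intro M' hM'
      obtain ⟨hM', h | h⟩ := mem_filter.1 hM'
      · obtain ⟨x, hx, y, hy, hxy⟩ := h
        exact mem_biUnion.2 ⟨x, hx, mem_union_left _ (mem_filter.2 ⟨hM', y, hy, hxy.symm⟩)⟩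
      · obtain ⟨x, hx, y, hy, hxy⟩ := h
        exact mem_biUnion.2 ⟨x, hx, mem_union_right _ (mem_filter.2 ⟨hM', y, hy, hxy.symm⟩)⟩
    refine (sum_le_sum_of_subset hsub).trans ?_
    refine (sum_biUnion_le _ _ _).trans (sum_le_sum fun x _ => ?_)
    refine (sum_union_le _ _ _).trans (Nat.add_le_add ?_ ?_)
    · refine sum_card_extending_le blk bad hbad (fun _ => x.1) _ (filter_subset _ _) ?_
      exact fun M' hM' π _ => (mem_filter.1 hM').2
    · refine sum_card_extending_le blk bad hbad (fun π => π.symm x.2) _ (filter_subset _ _) ?_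
      intro M' hM' π hπ
      obtain ⟨y, hy, hyx⟩ := (mem_filter.1 hM').2
      refine ⟨y, hy, ?_⟩
      rw [Equiv.eq_symm_apply, mem_extending.1 hπ y hy, hyx]
  calc 8 * w * ∑ M' ∈ badGraphs blk bad with Meets M M', (extending M').card
      ≤ 8 * w * ∑ x ∈ M, ((univ.filter fun π : Equiv.Perm V => bad (blk x.1) π).card +
        (univ.filter fun π : Equiv.Perm V => bad (blk (π.symm x.2)) π).card) :=
        Nat.mul_le_mul_left _ h3
    _ ≤ ∑ x ∈ M, Fintype.card (Equiv.Perm V) := by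
        rw [mul_sum]
        refine sum_le_sum fun x _ => ?_
        have := h1 x.1
        have := h2 x.2
        nlinarith
    _ = _ := by rw [sum_const, smul_eq_mul]

/-- If each block of a random permutation is unlikely to be bad, then there is a spread family of
permutations without bad blocks. -/
lemma exists_spread_perms (blk : V → J) (w : ℕ) (hw0 : 0 < w)
    (hw : ∀ p, (univ.filter fun q => blk q = blk p).card ≤ w)
    (bad : J → Equiv.Perm V → Prop)
    (hbad : ∀ j π π', (∀ q, blk q = j → π q = π' q) → bad j π → bad j π')
    (hconc : ∀ p v, 16 * w * Fintype.card V *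
      (univ.filter fun π : Equiv.Perm V => π p = v ∧ bad (blk p) π).card ≤
        Fintype.card (Equiv.Perm V)) :
    ∃ G : Finset (Equiv.Perm V), G.Nonempty ∧ (∀ π ∈ G, ∀ p, ¬ bad (blk p) π) ∧
      ∀ M : Finset (V × V), ((G ∩ extending M).card : ℝ) * (Fintype.card V : ℝ) ^ M.card ≤
        Real.exp 2 ^ M.card * G.card := by
  set I := badGraphs blk bad
  have hmeets := sum_card_meets_le blk w bad hbad hconc
  have hΩ : 0 < Fintype.card (Equiv.Perm V) := Fintype.card_pos
  have hΩ' : (0 : ℝ) < Fintype.card (Equiv.Perm V) := by exact_mod_cast hΩ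
  have hcardI : ∀ M ∈ I, M.card ≤ w := by
    intro M hM
    obtain ⟨p, π, -, rfl⟩ := (mem_filter.1 hM).2
    refine le_trans (card_le_card_of_injOn Prod.fst (fun x hx => ?_) fun x hx y hy hxy => ?_)
      (hw p)
    · exact mem_coe.2 (mem_filter.2 ⟨mem_univ _, (mem_blockGraph.1 (mem_coe.1 hx)).1⟩)
    · have h1 := (mem_blockGraph.1 (mem_coe.1 hx)).2
      have h2 := (mem_blockGraph.1 (mem_coe.1 hy)).2
      exact Prod.ext hxy (by rw [← h1, ← h2, hxy])
  have hrefl : ∀ M ∈ I, Meets M M := by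
    intro M hM
    obtain ⟨p, π, -, rfl⟩ := (mem_filter.1 hM).2
    have : (p, π p) ∈ blockGraph blk π (blk p) := mem_blockGraph.2 ⟨rfl, rfl⟩
    exact Or.inl ⟨_, this, _, this, rfl⟩
  have hlop : ∀ M ∈ I, ∀ S ⊆ I, (∀ M' ∈ S, ¬ Meets M M') →
      (extending M ∩ avoiding extending S).card * Fintype.card (Equiv.Perm V) ≤
        (extending M).card * (avoiding extending S).card := fun M _ S _ h =>
    card_extending_inter_le M S h
  have hsum : ∀ M ∈ I, ∑ M' ∈ I with Meets M M', 4 * (extending M').card ≤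
      Fintype.card (Equiv.Perm V) := by
    intro M hM
    rw [← mul_sum]
    refine Nat.le_of_mul_le_mul_left ?_ hw0
    have h1 := (hmeets M).trans (Nat.mul_le_mul_right (Fintype.card (Equiv.Perm V)) (hcardI M hM))
    refine le_trans ?_ h1
    rw [← mul_assoc]
    exact Nat.mul_le_mul_right _ (by omega)
  have hge := card_avoiding_ge extending Meets I hlop hsum hrefl hΩ
  refine ⟨avoiding extending I, ?_, ?_, ?_⟩
  · have := hge ∅ I (empty_subset _) subset_rfl
    rw [empty_union] at this
    have h0 : (avoiding extending (∅ : Finset (Finset (V × V)))) = univ := by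
      ext; simp [mem_avoiding]
    rw [h0, card_univ] at this
    rw [← card_pos]
    have h1 : (0 : ℝ) < (avoiding extending I).card := lt_of_lt_of_le (by positivity) this
    exact_mod_cast h1
  · intro π hπ p hbadp
    refine mem_avoiding.1 hπ (blockGraph blk π (blk p))
      (mem_filter.2 ⟨mem_univ _, p, π, hbadp, rfl⟩) (mem_extending.2 fun x hx => ?_)
    exact (mem_blockGraph.1 hx).2
  · intro M
    set S := I.filter fun M' => ¬ Meets M M' with hS
    set T := I.filter fun M' => Meets M M' with hT
    have hST : S ∪ T = I := by
      rw [union_comm]; exact filter_union_filter_not_eq _ _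
    have h1 : ((avoiding extending I ∩ extending M).card : ℝ) ≤
        (extending M ∩ avoiding extending S).card := by
      rw [inter_comm]
      exact_mod_cast card_le_card (inter_subset_inter_left
        (avoiding_anti _ (filter_subset _ _)))
    have h2 : ((extending M ∩ avoiding extending S).card : ℝ) * Fintype.card (Equiv.Perm V) ≤
        (extending M).card * (avoiding extending S).card := by
      exact_mod_cast card_extending_inter_le M S fun M' hM' => (mem_filter.1 hM').2
    have h3 := card_extending_mul_pow_le M
    have h4 := hge S T (filter_subset _ _) (filter_subset _ _)
    rw [hST] at h4
    have h5 : (∑ j ∈ T, 4 * ((extending j).card : ℝ)) / Fintype.card (Equiv.Perm V) ≤ M.card := by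
      rw [div_le_iff₀ hΩ', ← mul_sum]
      have h6 : 8 * w * ∑ M' ∈ T, (extending M').card ≤
        M.card * Fintype.card (Equiv.Perm V) := hmeets M
      have h7 : 4 * ∑ M' ∈ T, (extending M').card ≤ M.card * Fintype.card (Equiv.Perm V) := by
        refine le_trans ?_ h6
        exact Nat.mul_le_mul_right _ (by omega)
      exact_mod_cast h7
    have h8 : ((avoiding extending S).card : ℝ) ≤
        Real.exp M.card * (avoiding extending I).card := by
      have h9 : Real.exp (-(M.card : ℝ)) * (avoiding extending S).card ≤
          (avoiding extending I).card := by
        refine le_trans ?_ h4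
        rw [mul_comm]
        gcongr
      rw [Real.exp_neg, inv_mul_le_iff₀ (Real.exp_pos _)] at h9
      exact h9
    have hexp : Real.exp 2 ^ M.card = Real.exp 1 ^ M.card * Real.exp M.card := by
      rw [← Real.exp_nat_mul, ← Real.exp_nat_mul, ← Real.exp_add]
      congr 1
      ring
    rw [hexp]
    refine le_of_mul_le_mul_right ?_ hΩ'
    calc ((avoiding extending I ∩ extending M).card : ℝ) * (Fintype.card V : ℝ) ^ M.card *
          Fintype.card (Equiv.Perm V)
        ≤ (extending M ∩ avoiding extending S).card * (Fintype.card V : ℝ) ^ M.card *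
          Fintype.card (Equiv.Perm V) := by gcongr
      _ = ((extending M ∩ avoiding extending S).card * Fintype.card (Equiv.Perm V)) *
          (Fintype.card V : ℝ) ^ M.card := by ring
      _ ≤ ((extending M).card * (avoiding extending S).card) *
          (Fintype.card V : ℝ) ^ M.card := by gcongr
      _ = ((extending M).card * (Fintype.card V : ℝ) ^ M.card) *
          (avoiding extending S).card := by ring
      _ ≤ (Real.exp 1 ^ M.card * Fintype.card (Equiv.Perm V)) *
          (Real.exp M.card * (avoiding extending I).card) := by gcongr
      _ = _ := by ring

end SpreadPermutations

section Concentration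

lemma exp_neg_le {x : ℝ} (hx : 0 ≤ x) : Real.exp (-x) ≤ 1 - x + x ^ 2 / 2 := by
  have h1 := Real.quadratic_le_exp_of_nonneg hx
  rw [Real.exp_neg, inv_le_iff_one_le_mul₀ (Real.exp_pos _)]
  have h2 : 0 ≤ 1 - x + x ^ 2 / 2 := by nlinarith [sq_nonneg (x - 1)]
  nlinarith [mul_le_mul_of_nonneg_left h1 h2, sq_nonneg (x ^ 2)]

variable {V : Type*} [Fintype V] [DecidableEq V]

lemma card_image_univ_eq (r : ℕ) (S : Finset V) (hS : S.card = r) :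
    (univ.filter fun f : Fin r → V => univ.image f = S).card = r.factorial := by
  have e : Fin r ≃ S := (S.equivFinOfCardEq hS).symm
  have h1 : (univ : Finset (Equiv.Perm (Fin r))).card = r.factorial := by
    rw [card_univ, Fintype.card_perm, Fintype.card_fin]
  rw [← h1]
  symm
  refine card_bij (fun σ _ => fun x => (e (σ x) : V)) (fun σ _ => ?_) (fun σ _ τ _ h => ?_) ?_
  · refine mem_filter.2 ⟨mem_univ _, ?_⟩
    ext v
    simp only [mem_image, mem_univ, true_and]
    constructor
    · rintro ⟨x, rfl⟩
      exact (e (σ x)).2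
    · intro hv
      exact ⟨σ.symm (e.symm ⟨v, hv⟩), by simp⟩
  · ext x
    have h' : e (σ x) = e (τ x) := Subtype.ext (congrFun h x)
    rw [e.injective h']
  · intro f hf
    have hf' := (mem_filter.1 hf).2
    have hinj : Function.Injective f := by
      rw [← Set.injOn_univ, ← coe_univ, ← card_image_iff, hf', hS, card_univ, Fintype.card_fin]
    have hmem : ∀ x, f x ∈ S := fun x => hf' ▸ mem_image_of_mem f (mem_univ x)
    have hg : Function.Injective fun x => e.symm ⟨f x, hmem x⟩ := fun x y hxy => by
      simpa using hinj (by simpa using hxy)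
    refine ⟨Equiv.ofBijective _ (Finite.injective_iff_bijective.1 hg), mem_univ _, ?_⟩
    ext x
    simp

lemma factorial_mul_card_le (r : ℕ) (L : Finset (Finset V)) (hL : ∀ S ∈ L, S.card = r) :
    r.factorial * L.card = (univ.filter fun f : Fin r → V => univ.image f ∈ L).card := by
  rw [card_eq_sum_card_fiberwise (f := fun f : Fin r → V => univ.image f) (t := L)
    (fun f hf => mem_coe.2 (mem_filter.1 (mem_coe.1 hf)).2), mul_comm, ← smul_eq_mul, ← sum_const]
  refine sum_congr rfl fun S hS => ?_
  rw [← card_image_univ_eq r S (hL S hS), filter_filter]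
  congr 1
  refine filter_congr fun f _ => ⟨fun h => ⟨by dsimp only; rwa [h], h⟩, fun h => h.2⟩

lemma sum_exp_tuple_le (r : ℕ) (L : Finset (Finset V)) (hL : ∀ S ∈ L, S.card = r)
    {α x : ℝ} (hx : 0 ≤ x) (hLα : α * (Fintype.card V : ℝ) ^ r ≤ r.factorial * L.card) (hα : 0 ≤ α) :
    ∑ f : Fin r → V, (if univ.image f ∈ L then Real.exp (-x) else 1) ≤
      (Fintype.card V : ℝ) ^ r * Real.exp (-(x * α) + x ^ 2 / 2) := by
  have h1 : ((r.factorial * L.card : ℕ) : ℝ) =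
      (univ.filter fun f : Fin r → V => univ.image f ∈ L).card := by
    rw [factorial_mul_card_le r L hL]
  push_cast at h1
  set c := (univ.filter fun f : Fin r → V => univ.image f ∈ L).card
  have hc : (c : ℝ) ≤ (Fintype.card V : ℝ) ^ r := by
    have : c ≤ Fintype.card V ^ r := by
      refine (card_le_univ _).trans (le_of_eq ?_)
      simp
    exact_mod_cast this
  have h2 : ∑ f : Fin r → V, (if univ.image f ∈ L then Real.exp (-x) else 1) =
      (Fintype.card V : ℝ) ^ r - (1 - Real.exp (-x)) * c := by
    have : ∀ f : Fin r → V, (if univ.image f ∈ L then Real.exp (-x) else 1) =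
        1 - (1 - Real.exp (-x)) * (if univ.image f ∈ L then 1 else 0) := by
      intro f
      split_ifs <;> ring
    rw [sum_congr rfl fun f _ => this f, sum_sub_distrib, ← mul_sum, sum_boole]
    simp [c]
  rw [h2]
  rw [h1] at hLα
  have h3 := exp_neg_le hx
  have h4 : 1 - Real.exp (-x) ≥ 0 := by
    have := Real.exp_le_one_iff.2 (neg_nonpos.2 hx)
    linarith
  have h5 : (0 : ℝ) ≤ (Fintype.card V : ℝ) ^ r := by positivity
  have h6 := Real.add_one_le_exp (-(x * α) + x ^ 2 / 2)
  have h7 : (Fintype.card V : ℝ) ^ r * (-(x * α) + x ^ 2 / 2 + 1) ≤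
      (Fintype.card V : ℝ) ^ r * Real.exp (-(x * α) + x ^ 2 / 2) :=
    mul_le_mul_of_nonneg_left h6 h5
  have h8 : (1 - Real.exp (-x)) * (α * (Fintype.card V : ℝ) ^ r) ≤ (1 - Real.exp (-x)) * c :=
    mul_le_mul_of_nonneg_left hLα h4
  have h9 : (x - x ^ 2 / 2) * (α * (Fintype.card V : ℝ) ^ r) ≤
      (1 - Real.exp (-x)) * (α * (Fintype.card V : ℝ) ^ r) :=
    mul_le_mul_of_nonneg_right (by linarith) (by positivity)
  have h10 : x ^ 2 / 2 * (α * (Fintype.card V : ℝ) ^ r) ≤ x ^ 2 / 2 * (Fintype.card V : ℝ) ^ r :=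
    mul_le_mul_of_nonneg_left (hLα.trans hc) (by positivity)
  linarith

variable {W : Type*} [Fintype W] [DecidableEq W]

/-- The number of `r`-subsets whose image under `g` belongs to `L`. -/
noncomputable def imageCount (r : ℕ) (L : Finset (Finset V)) (g : W → V) : ℕ :=
  ((powersetCard r univ).filter fun I : Finset W => I.image g ∈ L).card

lemma card_perm_image_eq (A B : Finset W) (h : A.card = B.card) (R : Finset W) :
    (univ.filter fun ρ : Equiv.Perm W => R.image ρ = A).card =
      (univ.filter fun ρ : Equiv.Perm W => R.image ρ = B).card := by
  have e : (A : Finset W) ≃ B := Finset.equivOfCardEq h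
  obtain ⟨σ, hσ⟩ : ∃ σ : Equiv.Perm W, A.image σ = B := by
    refine ⟨e.extendSubtype, ?_⟩
    have hsub : A.image (e.extendSubtype) ⊆ B := by
      intro v hv
      obtain ⟨a, ha, rfl⟩ := mem_image.1 hv
      exact e.extendSubtype_mem a ha
    refine eq_of_subset_of_card_le hsub ?_
    rw [card_image_of_injective _ (Equiv.injective _), h]
  refine card_bij' (fun ρ _ => σ * ρ) (fun ρ _ => σ⁻¹ * ρ) (fun ρ hρ => ?_) (fun ρ hρ => ?_)
    (fun ρ _ => by simp) (fun ρ _ => by simp)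
  · refine mem_filter.2 ⟨mem_univ _, ?_⟩
    rw [Equiv.Perm.coe_mul, ← image_image, (mem_filter.1 hρ).2, hσ]
  · refine mem_filter.2 ⟨mem_univ _, ?_⟩
    rw [Equiv.Perm.coe_mul, ← image_image, (mem_filter.1 hρ).2, ← hσ, image_image]
    simp

lemma choose_mul_card_perm_image (r : ℕ) (L : Finset (Finset V)) (g : W → V) (R : Finset W)
    (hR : R.card = r) :
    (Fintype.card W).choose r *
        (univ.filter fun ρ : Equiv.Perm W => (R.image ρ).image g ∈ L).card =
      imageCount r L g * Fintype.card (Equiv.Perm W) := by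
  have hmem : ∀ ρ : Equiv.Perm W, R.image ρ ∈ powersetCard r (univ : Finset W) := fun ρ =>
    mem_powersetCard.2 ⟨subset_univ _, by rw [card_image_of_injective _ ρ.injective, hR]⟩
  set c := (univ.filter fun ρ : Equiv.Perm W => R.image ρ = R).card with hc
  have hc' : ∀ I ∈ powersetCard r (univ : Finset W),
      (univ.filter fun ρ : Equiv.Perm W => R.image ρ = I).card = c := fun I hI =>
    card_perm_image_eq I R (by rw [hR, (mem_powersetCard.1 hI).2]) R
  have h1 : Fintype.card (Equiv.Perm W) = (Fintype.card W).choose r * c := by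
    rw [← card_univ, card_eq_sum_card_fiberwise (f := fun ρ : Equiv.Perm W => R.image ρ)
      (fun ρ _ => mem_coe.2 (hmem ρ)), sum_congr rfl hc', sum_const, card_powersetCard, card_univ,
      smul_eq_mul]
  have h2 : (univ.filter fun ρ : Equiv.Perm W => (R.image ρ).image g ∈ L).card =
      imageCount r L g * c := by
    rw [imageCount, card_eq_sum_card_fiberwise (f := fun ρ : Equiv.Perm W => R.image ρ)
      (t := (powersetCard r univ).filter fun I : Finset W => I.image g ∈ L)
      (fun ρ hρ => mem_coe.2 (mem_filter.2 ⟨hmem ρ, (mem_filter.1 (mem_coe.1 hρ)).2⟩)),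
      ← smul_eq_mul, ← sum_const]
    refine sum_congr rfl fun I hI => ?_
    rw [← hc' I (mem_filter.1 hI).1, filter_filter]
    congr 1
    refine filter_congr fun ρ _ => ⟨fun h => h.2, fun h => ⟨by dsimp only; rw [h]; exact (mem_filter.1 hI).2, h⟩⟩
  rw [h1, h2]
  ring

lemma card_imageCount_le (m r : ℕ) (e : Fin m × Fin r ≃ W) (L : Finset (Finset V))
    (hL : ∀ S ∈ L, S.card = r) {α x : ℝ} (hα : 0 ≤ α) (hx : 0 ≤ x)
    (hLα : α * (Fintype.card V : ℝ) ^ r ≤ r.factorial * L.card) :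
    ((univ.filter fun g : W → V =>
        (imageCount r L g : ℝ) ≤ (α - x) * (Fintype.card W).choose r).card : ℝ) ≤
      Real.exp (-(m * (x ^ 2 / 2))) * (Fintype.card V : ℝ) ^ (m * r) := by
  set row : Fin m → Finset W := fun i => univ.image fun j => e (i, j)
  have hrow : ∀ i, (row i).card = r := fun i => by
    rw [card_image_of_injective _ fun j j' h => by simpa using h, card_univ, Fintype.card_fin]
  set X : (W → V) → ℕ := fun g => (univ.filter fun i => (row i).image g ∈ L).card with hX
  set B := univ.filter fun g : W → V =>
    (imageCount r L g : ℝ) ≤ (α - x) * (Fintype.card W).choose r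
  have hWc : 0 < (Fintype.card W).choose r ∨ m = 0 := by
    rcases Nat.eq_zero_or_pos m with h | h
    · exact Or.inr h
    · left
      rw [← Fintype.card_congr e, Fintype.card_prod, Fintype.card_fin, Fintype.card_fin]
      exact Nat.choose_pos (Nat.le_mul_of_pos_left r h)
  have hP : (0 : ℝ) < Fintype.card (Equiv.Perm W) := by exact_mod_cast Fintype.card_pos
  -- the exponential moment
  have hmgf : ∑ g : W → V, Real.exp (-(x * X g)) ≤
      (Fintype.card V : ℝ) ^ (m * r) * Real.exp (m * (-(x * α) + x ^ 2 / 2)) := by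
    have h1 := sum_exp_tuple_le r L hL hx hLα hα
    have h2 : ∑ g : W → V, Real.exp (-(x * X g)) =
        (∑ f : Fin r → V, (if univ.image f ∈ L then Real.exp (-x) else 1)) ^ m := by
      rw [Fintype.sum_pow]
      refine Fintype.sum_equiv ((e.arrowCongr (Equiv.refl V)).symm.trans
        (Equiv.curry (Fin m) (Fin r) V)) _ _ fun g => ?_
      have h3 : ∀ i : Fin m, (row i).image g = univ.image fun j => g (e (i, j)) := fun i => by
        rw [image_image]; rfl
      simp only [hX, h3]
      rw [prod_ite, prod_const, prod_const_one, mul_one, ← Real.exp_nat_mul]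
      congr 1
      rw [mul_neg, mul_comm]
      rfl
    rw [h2]
    calc _ ≤ ((Fintype.card V : ℝ) ^ r * Real.exp (-(x * α) + x ^ 2 / 2)) ^ m := by
          refine pow_le_pow_left₀ (sum_nonneg fun f _ => ?_) h1 m
          split_ifs <;> positivity
      _ = _ := by
        rw [mul_pow, ← pow_mul, ← Real.exp_nat_mul, mul_comm r m]
  -- averaging over permutations
  have havg : ∀ g ∈ B, Fintype.card (Equiv.Perm W) * Real.exp (-(x * (m * (α - x)))) ≤
      ∑ ρ : Equiv.Perm W, Real.exp (-(x * X (g ∘ ρ))) := by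
    intro g hg
    have h1 : (∑ ρ : Equiv.Perm W, (X (g ∘ ρ) : ℝ)) ≤
        Fintype.card (Equiv.Perm W) * (m * (α - x)) := by
      have h2 : (Fintype.card W).choose r * ∑ ρ : Equiv.Perm W, X (g ∘ ρ) =
          m * (imageCount r L g * Fintype.card (Equiv.Perm W)) := by
        have h3 : ∑ ρ : Equiv.Perm W, X (g ∘ ρ) = ∑ i : Fin m,
            (univ.filter fun ρ : Equiv.Perm W => ((row i).image ρ).image g ∈ L).card := by
          simp only [hX, image_image]
          exact (sum_card_bipartiteAbove_eq_sum_card_bipartiteBelow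
            (fun (i : Fin m) (ρ : Equiv.Perm W) => (row i).image (g ∘ ρ) ∈ L)).symm
        rw [h3, mul_sum, sum_congr rfl fun i _ => choose_mul_card_perm_image r L g (row i) (hrow i),
          sum_const, card_univ, Fintype.card_fin, smul_eq_mul]
      rcases hWc with hWc | rfl
      · have hWc' : (0 : ℝ) < (Fintype.card W).choose r := by exact_mod_cast hWc
        refine le_of_mul_le_mul_left ?_ hWc'
        have h2' : ((Fintype.card W).choose r : ℝ) * ∑ ρ : Equiv.Perm W, (X (g ∘ ρ) : ℝ) =
          m * (imageCount r L g * Fintype.card (Equiv.Perm W)) := by exact_mod_cast h2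
        rw [h2']
        have h4 := (mem_filter.1 hg).2
        calc (m : ℝ) * (imageCount r L g * Fintype.card (Equiv.Perm W))
            ≤ m * (((α - x) * (Fintype.card W).choose r) * Fintype.card (Equiv.Perm W)) := by
              gcongr
          _ = _ := by ring
      · simp [hX]
    have h5 : ∀ ρ : Equiv.Perm W, Real.exp (-(x * (m * (α - x)))) *
        (1 + x * (m * (α - x)) - x * X (g ∘ ρ)) ≤ Real.exp (-(x * X (g ∘ ρ))) := by
      intro ρ
      have h6 := Real.add_one_le_exp (x * (m * (α - x)) - x * X (g ∘ ρ))
      have h7 : Real.exp (-(x * X (g ∘ ρ))) = Real.exp (-(x * (m * (α - x)))) *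
          Real.exp (x * (m * (α - x)) - x * X (g ∘ ρ)) := by
        rw [← Real.exp_add]
        congr 1
        ring
      rw [h7]
      refine mul_le_mul_of_nonneg_left ?_ (Real.exp_pos _).le
      linarith
    refine le_trans ?_ (sum_le_sum fun ρ _ => h5 ρ)
    rw [← mul_sum, sum_sub_distrib, sum_const, card_univ, nsmul_eq_mul, ← mul_sum, mul_comm]
    refine mul_le_mul_of_nonneg_left ?_ (Real.exp_pos _).le
    nlinarith [mul_le_mul_of_nonneg_left h1 hx]
  have hsymm : ∑ g : W → V, ∑ ρ : Equiv.Perm W, Real.exp (-(x * X (g ∘ ρ))) =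
      Fintype.card (Equiv.Perm W) * ∑ g : W → V, Real.exp (-(x * X g)) := by
    rw [sum_comm]
    have : ∀ ρ : Equiv.Perm W, ∑ g : W → V, Real.exp (-(x * X (g ∘ ρ))) =
        ∑ g : W → V, Real.exp (-(x * X g)) := fun ρ =>
      Fintype.sum_equiv (ρ.symm.arrowCongr (Equiv.refl V)) _ _ fun g => rfl
    rw [sum_congr rfl fun ρ _ => this ρ, sum_const, card_univ, nsmul_eq_mul]
  have h1 : (B.card : ℝ) * (Fintype.card (Equiv.Perm W) * Real.exp (-(x * (m * (α - x))))) ≤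
      Fintype.card (Equiv.Perm W) * ((Fintype.card V : ℝ) ^ (m * r) *
        Real.exp (m * (-(x * α) + x ^ 2 / 2))) := by
    calc _ = ∑ g ∈ B, Fintype.card (Equiv.Perm W) * Real.exp (-(x * (m * (α - x)))) := by
          rw [sum_const, nsmul_eq_mul]
      _ ≤ ∑ g ∈ B, ∑ ρ : Equiv.Perm W, Real.exp (-(x * X (g ∘ ρ))) := sum_le_sum havg
      _ ≤ ∑ g : W → V, ∑ ρ : Equiv.Perm W, Real.exp (-(x * X (g ∘ ρ))) :=
          sum_le_univ_sum_of_nonneg fun g => sum_nonneg fun ρ _ => (Real.exp_pos _).le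
      _ = _ := hsymm
      _ ≤ _ := mul_le_mul_of_nonneg_left hmgf hP.le
  have h2 : (B.card : ℝ) * Real.exp (-(x * (m * (α - x)))) ≤
      (Fintype.card V : ℝ) ^ (m * r) * Real.exp (m * (-(x * α) + x ^ 2 / 2)) := by
    refine le_of_mul_le_mul_left ?_ hP
    calc _ = (B.card : ℝ) *
          (Fintype.card (Equiv.Perm W) * Real.exp (-(x * (m * (α - x))))) := by ring
      _ ≤ _ := h1
  have h3 : Real.exp (-(m * (x ^ 2 / 2))) = Real.exp (m * (-(x * α) + x ^ 2 / 2)) *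
      (Real.exp (-(x * (m * (α - x)))))⁻¹ := by
    rw [← Real.exp_neg, ← Real.exp_add]
    congr 1
    ring
  rw [h3, mul_comm, ← mul_assoc, ← div_eq_mul_inv, le_div_iff₀ (Real.exp_pos _)]
  exact h2

end Concentration

section Blocks

lemma card_mul_card_apply_eq {P V : Type*} [Fintype P] [DecidableEq P] [Fintype V]
    [DecidableEq V] (x : P) (v : V) :
    Fintype.card V * (univ.filter fun c : P → V => c x = v).card =
      Fintype.card V ^ Fintype.card P := by
  have h1 : (univ.filter fun c : P → V => c x = v) =
      Fintype.piFinset fun i => if i = x then {v} else univ := by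
    ext c
    simp only [mem_filter, mem_univ, true_and, Fintype.mem_piFinset]
    constructor
    · rintro rfl i
      by_cases h : i = x
      · subst h; simp
      · simp [h]
    · intro h
      simpa using h x
  rw [h1, Fintype.card_piFinset, ← mul_prod_erase univ _ (mem_univ x)]
  have h2 : ∀ i ∈ univ.erase x, (if i = x then ({v} : Finset V) else univ).card =
      Fintype.card V := fun i hi => by
    rw [if_neg (ne_of_mem_erase hi), card_univ]
  rw [prod_congr rfl h2, if_pos rfl, card_singleton, one_mul, prod_const,
    card_erase_of_mem (mem_univ x), card_univ, ← pow_succ',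
    Nat.sub_add_cancel (Fintype.card_pos_iff.2 ⟨x⟩)]

lemma card_functions_le {P V : Type*} [Fintype P] [DecidableEq P] [Fintype V] [DecidableEq V]
    (W : Finset P) (x : P) (hx : x ∉ W) (v : V) (Q : (P → V) → Prop)
    [DecidablePred Q] (η : ℝ)
    (hQ : ∀ c : {i // i ∉ W} → V, ((univ.filter fun g : {i // i ∈ W} → V =>
      Q ((Equiv.piEquivPiSubtypeProd (· ∈ W) fun _ => V).symm (g, c))).card : ℝ) ≤
        η * (Fintype.card V : ℝ) ^ W.card) :
    (Fintype.card V : ℝ) * (univ.filter fun h : P → V => h x = v ∧ Q h).card ≤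
      η * (Fintype.card V : ℝ) ^ Fintype.card P := by
  set e := Equiv.piEquivPiSubtypeProd (· ∈ W) fun _ : P => V
  have h1 : (univ.filter fun h : P → V => h x = v ∧ Q h).card =
      ∑ c ∈ univ.filter (fun c : {i // i ∉ W} → V => c ⟨x, hx⟩ = v),
        (univ.filter fun g : {i // i ∈ W} → V => Q (e.symm (g, c))).card := by
    rw [← card_sigma]
    refine card_bij' (fun h _ => ⟨(e h).2, (e h).1⟩) (fun y _ => e.symm (y.2, y.1))
      (fun h hh => ?_) (fun y hy => ?_) (fun h _ => by simp) (fun y _ => by simp)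
    · obtain ⟨h2, h3⟩ := (mem_filter.1 hh).2
      refine mem_sigma.2 ⟨mem_filter.2 ⟨mem_univ _, h2⟩, mem_filter.2 ⟨mem_univ _, ?_⟩⟩
      simpa using h3
    · obtain ⟨h2, h3⟩ := mem_sigma.1 hy
      refine mem_filter.2 ⟨mem_univ _, ?_, (mem_filter.1 h3).2⟩
      have h4 := (mem_filter.1 h2).2
      simpa [e, Equiv.piEquivPiSubtypeProd, hx] using h4
  have h2 := card_mul_card_apply_eq (⟨x, hx⟩ : {i // i ∉ W}) v
  have h3 : Fintype.card {i // i ∉ W} + W.card = Fintype.card P := by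
    have := card_le_univ W
    rw [Fintype.card_subtype_compl, Fintype.card_coe]
    omega
  rw [h1]
  push_cast
  calc (Fintype.card V : ℝ) * _ ≤ (Fintype.card V : ℝ) *
        ∑ c ∈ univ.filter (fun c : {i // i ∉ W} → V => c ⟨x, hx⟩ = v),
          η * (Fintype.card V : ℝ) ^ W.card := by
        gcongr with c
        exact hQ c
    _ = ((Fintype.card V * (univ.filter fun c : {i // i ∉ W} → V => c ⟨x, hx⟩ = v).card : ℕ) : ℝ) *
          (η * (Fintype.card V : ℝ) ^ W.card) := by
        rw [sum_const, nsmul_eq_mul]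
        push_cast
        ring
    _ = _ := by
        rw [h2, ← h3, pow_add]
        push_cast
        ring

variable {n : ℕ}

/-- The sets completing `S` to an edge of `H`. -/
noncomputable def linkOf (H : Finset (Finset (Fin n))) (r : ℕ) (S : Finset (Fin n)) :
    Finset (Finset (Fin n)) :=
  (powersetCard r univ).filter fun e => Disjoint e S ∧ e ∪ S ∈ H

lemma degOf_le_card_linkOf (H : Finset (Finset (Fin n))) (l r : ℕ)
    (hH : ∀ E ∈ H, E.card = l + r) (S : Finset (Fin n)) (hS : S.card = l) :
    degOf H S ≤ (linkOf H r S).card := by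
  refine card_le_card_of_injOn (fun E => E \ S) (fun E hE => ?_) fun E hE E' hE' h => ?_
  · obtain ⟨h1, h2⟩ := mem_filter.1 (mem_coe.1 hE)
    refine mem_coe.2 (mem_filter.2 ⟨mem_powersetCard.2 ⟨subset_univ _, ?_⟩, sdiff_disjoint, ?_⟩)
    · rw [card_sdiff_of_subset h2, hH E h1, hS]
      omega
    · rwa [sdiff_union_of_subset h2]
  · have h1 := (mem_filter.1 (mem_coe.1 hE)).2
    have h2 := (mem_filter.1 (mem_coe.1 hE')).2
    dsimp only at h
    rw [← sdiff_union_of_subset h1, h, sdiff_union_of_subset h2]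

/-- The hypergraph pulled back along `h`. -/
noncomputable def pullback {t : ℕ} (H : Finset (Finset (Fin n))) (h : Fin t → Fin n) :
    Finset (Finset (Fin t)) :=
  univ.filter fun E => E.image h ∈ H

lemma mem_pullback {t : ℕ} {H : Finset (Finset (Fin n))} {h : Fin t → Fin n}
    {E : Finset (Fin t)} : E ∈ pullback H h ↔ E.image h ∈ H := by
  simp [pullback]

lemma imageCount_le_degOf {t : ℕ} (H : Finset (Finset (Fin n))) (r : ℕ) (h : Fin t → Fin n)
    (T W : Finset (Fin t)) (hTW : Disjoint W T) :
    imageCount r (linkOf H r (T.image h)) (fun w : {i // i ∈ W} => h w) ≤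
      degOf (pullback H h) T := by
  have hd : ∀ I : Finset {i // i ∈ W}, Disjoint (I.image Subtype.val) T := by
    intro I
    refine disjoint_of_subset_left ?_ hTW
    intro y hy
    obtain ⟨z, -, rfl⟩ := mem_image.1 hy
    exact z.2
  refine card_le_card_of_injOn (fun I => I.image Subtype.val ∪ T) (fun I hI => ?_)
    fun I _ I' _ hII => ?_
  · obtain ⟨-, h1⟩ := mem_filter.1 (mem_coe.1 hI)
    refine mem_coe.2 (mem_filter.2 ⟨mem_pullback.2 ?_, subset_union_right⟩)
    have h2 := (mem_filter.1 h1).2.2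
    rw [image_union, image_image]
    exact h2
  · dsimp only at hII
    have h1 : I.image Subtype.val = I'.image Subtype.val := by
      rw [← union_sdiff_cancel_right (hd I), hII, union_sdiff_cancel_right (hd I')]
    exact image_injective Subtype.val_injective h1

lemma hasPM_of_tPM_le (t k l : ℕ) (hl : l ≤ t) (H : Finset (Finset (Fin t)))
    (hH : ∀ E ∈ H, E.card = k) (hd : ∀ T : Finset (Fin t), T.card = l → tPM t k l ≤ degOf H T) :
    HasPM H := by
  have hne : {d : ℕ | ∀ H : Finset (Finset (Fin t)), (∀ E ∈ H, E.card = k) →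
      (∀ T : Finset (Fin t), T.card = l → d ≤ degOf H T) → HasPM H}.Nonempty := by
    refine ⟨Fintype.card (Finset (Fin t)) + 1, fun H _ h => ?_⟩
    obtain ⟨T, -, hT⟩ := exists_subset_card_eq (s := (univ : Finset (Fin t))) (n := l)
      (by simpa using hl)
    have h1 := h T hT
    have h2 : degOf H T ≤ Fintype.card (Finset (Fin t)) := card_le_univ _
    omega
  exact Nat.sInf_mem hne H hH hd

lemma card_bad_injections_le {t k l r m : ℕ} (hk : k = l + r) (hlt : m * r + l + 1 ≤ t)
    (H : Finset (Finset (Fin n))) (hH : ∀ E ∈ H, E.card = k) {α γ : ℝ} (hα : 0 ≤ α) (hγ : 0 ≤ γ)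
    (hdeg : ∀ T : Finset (Fin n), T.card = l → α * (n : ℝ) ^ r ≤ r.factorial * degOf H T)
    (htPM : (tPM t k l : ℝ) ≤ (α - γ) * (m * r).choose r) (x : Fin t) (v : Fin n) :
    (n : ℝ) * (univ.filter fun h : Fin t → Fin n => h x = v ∧ Function.Injective h ∧
      ¬ HasPM (pullback H h)).card ≤
      t.choose l * (Real.exp (-(m * (γ ^ 2 / 2))) * (n : ℝ) ^ t) := by
  have hmain : ∀ T : Finset (Fin t), T.card = l →
      (n : ℝ) * (univ.filter fun h : Fin t → Fin n => h x = v ∧ (Function.Injective h ∧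
        degOf (pullback H h) T < tPM t k l)).card ≤
      Real.exp (-(m * (γ ^ 2 / 2))) * (n : ℝ) ^ t := by
    intro T hT
    obtain ⟨W, hWT, hWc⟩ := exists_subset_card_eq (s := (insert x T)ᶜ) (n := m * r) (by
      rw [card_compl, Fintype.card_fin]
      have := card_insert_le x T
      omega)
    have hxW : x ∉ W := fun h => (mem_compl.1 (hWT h)) (mem_insert_self _ _)
    have hWT' : Disjoint W T := by
      rw [disjoint_left]
      exact fun a ha haT => (mem_compl.1 (hWT ha)) (mem_insert_of_mem haT)
    have h1 := card_functions_le W x hxW v (fun h : Fin t → Fin n => Function.Injective h ∧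
        degOf (pullback H h) T < tPM t k l) (Real.exp (-(m * (γ ^ 2 / 2)))) ?_
    · rwa [Fintype.card_fin, Fintype.card_fin] at h1
    intro c
    rw [Fintype.card_fin, hWc]
    set e := Equiv.piEquivPiSubtypeProd (· ∈ W) fun _ : Fin t => Fin n
    have hin : ∀ g, ∀ w : {i // i ∈ W}, e.symm (g, c) w = g w := fun g w => by
      simp [e, Equiv.piEquivPiSubtypeProd]
    have hout : ∀ g g', T.image (e.symm (g, c)) = T.image (e.symm (g', c)) := fun g g' => by
      refine image_congr fun a ha => ?_
      have haW : a ∉ W := fun h => disjoint_left.1 hWT' h (mem_coe.1 ha)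
      simp [e, Equiv.piEquivPiSubtypeProd, haW]
    rcases (univ.filter fun g : {i // i ∈ W} → Fin n => Function.Injective (e.symm (g, c)) ∧
      degOf (pullback H (e.symm (g, c))) T < tPM t k l).eq_empty_or_nonempty with h0 | ⟨g₀, hg₀⟩
    · rw [h0, card_empty, Nat.cast_zero]
      positivity
    have hinj := (mem_filter.1 hg₀).2.1
    set S := T.image (e.symm (g₀, c)) with hS
    have hSc : S.card = l := by rw [hS, card_image_of_injective _ hinj, hT]
    set L := linkOf H r S with hL
    have hLc : α * (Fintype.card (Fin n) : ℝ) ^ r ≤ r.factorial * L.card := by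
      rw [Fintype.card_fin]
      refine (hdeg S hSc).trans ?_
      gcongr
      exact degOf_le_card_linkOf H l r (fun E hE => (hH E hE).trans hk) S hSc
    have eW : Fin m × Fin r ≃ {i // i ∈ W} :=
      Fintype.equivOfCardEq (by simp [hWc])
    have h2 := card_imageCount_le m r eW L
      (fun e he => (mem_powersetCard.1 (mem_filter.1 he).1).2) hα hγ hLc
    rw [Fintype.card_fin] at h2
    refine le_trans ?_ h2
    have : (univ.filter fun g : {i // i ∈ W} → Fin n => Function.Injective (e.symm (g, c)) ∧
        degOf (pullback H (e.symm (g, c))) T < tPM t k l) ⊆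
        univ.filter fun g : {i // i ∈ W} → Fin n =>
          (imageCount r L g : ℝ) ≤ (α - γ) * (Fintype.card {i // i ∈ W}).choose r := by
      intro g hg
      refine mem_filter.2 ⟨mem_univ _, ?_⟩
      have h3 := imageCount_le_degOf H r (e.symm (g, c)) T W hWT'
      rw [hout g g₀, ← hS, ← hL] at h3
      have h4 : (fun w : {i // i ∈ W} => e.symm (g, c) w) = g := funext (hin g)
      rw [h4] at h3
      rw [Fintype.card_coe, hWc]
      refine le_trans ?_ htPM
      exact_mod_cast h3.trans (mem_filter.1 hg).2.2.le
    exact_mod_cast card_le_card this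
  have hsub : (univ.filter fun h : Fin t → Fin n => h x = v ∧ Function.Injective h ∧
      ¬ HasPM (pullback H h)) ⊆ (powersetCard l univ).biUnion fun T =>
        univ.filter fun h : Fin t → Fin n => h x = v ∧ (Function.Injective h ∧
        degOf (pullback H h) T < tPM t k l) := by
    intro h hh
    obtain ⟨h1, h2, h3⟩ := (mem_filter.1 hh).2
    have h4 : ∃ T : Finset (Fin t), T.card = l ∧ degOf (pullback H h) T < tPM t k l := by
      by_contra hcon
      push Not at hcon
      refine h3 (hasPM_of_tPM_le t k l (by omega) _ (fun E hE => ?_) hcon)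
      rw [← hH _ (mem_pullback.1 hE), card_image_of_injective _ h2]
    obtain ⟨T, hT, hT'⟩ := h4
    exact mem_biUnion.2 ⟨T, mem_powersetCard.2 ⟨subset_univ _, hT⟩,
      mem_filter.2 ⟨mem_univ _, h1, h2, hT'⟩⟩
  have h5 : ((univ.filter fun h : Fin t → Fin n => h x = v ∧ Function.Injective h ∧
      ¬ HasPM (pullback H h)).card : ℝ) ≤ ∑ T ∈ powersetCard l (univ : Finset (Fin t)),
        ((univ.filter fun h : Fin t → Fin n => h x = v ∧ (Function.Injective h ∧
        degOf (pullback H h) T < tPM t k l)).card : ℝ) := by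
    exact_mod_cast (card_le_card hsub).trans card_biUnion_le
  calc _ ≤ (n : ℝ) * ∑ T ∈ powersetCard l (univ : Finset (Fin t)),
        ((univ.filter fun h : Fin t → Fin n => h x = v ∧ (Function.Injective h ∧
        degOf (pullback H h) T < tPM t k l)).card : ℝ) := by gcongr
    _ ≤ ∑ T ∈ powersetCard l (univ : Finset (Fin t)),
        Real.exp (-(m * (γ ^ 2 / 2))) * (n : ℝ) ^ t := by
      rw [mul_sum]
      exact sum_le_sum fun T hT => hmain T (mem_powersetCard.1 hT).2
    _ = _ := by
      rw [sum_const, card_powersetCard, card_univ, Fintype.card_fin, nsmul_eq_mul]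

end Blocks

section BlockPermutations

lemma pow_le_two_mul_descFactorial {n t : ℕ} (h : 2 * t ^ 2 ≤ n) (hn : 0 < n) :
    n ^ t ≤ 2 * n.descFactorial t := by
  have htn : t ≤ n := by nlinarith
  have h1 : ((n : ℝ) - t) ^ t ≤ n.descFactorial t := by
    have h2 : (n - t) ^ t ≤ n.descFactorial t :=
      (Nat.pow_le_pow_left (by omega) t).trans (Nat.pow_sub_le_descFactorial n t)
    rw [← Nat.cast_sub htn]
    exact_mod_cast h2
  have hn' : (0 : ℝ) < n := by exact_mod_cast hn
  have h3 : ((n : ℝ) - t) ^ t = (n : ℝ) ^ t * (1 + -(t / n)) ^ t := by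
    rw [← mul_pow]
    congr 1
    field_simp
    ring
  have h4 : (t : ℝ) / n ≤ 1 := by
    rw [div_le_one hn']
    exact_mod_cast htn
  have h5 := one_add_mul_le_pow (a := -((t : ℝ) / n)) (by linarith) t
  have h6 : (t : ℝ) * (t / n) ≤ 1 / 2 := by
    rw [← mul_div_assoc, div_le_iff₀ hn']
    have : (2 * t ^ 2 : ℝ) ≤ n := by exact_mod_cast h
    nlinarith
  have h7 : (n : ℝ) ^ t * (1 / 2) ≤ n.descFactorial t := by
    refine le_trans ?_ h1
    rw [h3]
    refine mul_le_mul_of_nonneg_left ?_ (by positivity)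
    linarith
  have h8 : (n : ℝ) ^ t ≤ 2 * n.descFactorial t := by linarith
  exact_mod_cast h8

variable {n : ℕ}

lemma card_perms_comp_eq_le {t : ℕ} (b : Fin t → Fin n) (hb : Function.Injective b)
    (h : Fin t → Fin n) :
    (univ.filter fun π : Equiv.Perm (Fin n) => ⇑π ∘ b = h).card ≤ (n - t).factorial := by
  set M : Finset (Fin n × Fin n) := univ.image fun y => (b y, h y)
  have hM : M.card = t := by
    rw [card_image_of_injective _ fun y y' hy => hb (Prod.mk.inj hy).1, card_univ,
      Fintype.card_fin]
  have h1 : (univ.filter fun π : Equiv.Perm (Fin n) => ⇑π ∘ b = h) ⊆ extending M := by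
    intro π hπ
    refine mem_extending.2 fun y hy => ?_
    obtain ⟨z, -, rfl⟩ := mem_image.1 hy
    exact congrFun (mem_filter.1 hπ).2 z
  refine (card_le_card h1).trans ?_
  rcases (extending M).eq_empty_or_nonempty with h0 | h0
  · rw [h0]
    simp
  · rw [card_extending h0, hM, Fintype.card_fin]

lemma card_bad_perms_le {t k l r m : ℕ} (hk : k = l + r) (hlt : m * r + l + 1 ≤ t)
    (htn : 2 * t ^ 2 ≤ n) (hn : 0 < n)
    (H : Finset (Finset (Fin n))) (hH : ∀ E ∈ H, E.card = k) {α γ : ℝ} (hα : 0 ≤ α) (hγ : 0 ≤ γ)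
    (hdeg : ∀ T : Finset (Fin n), T.card = l → α * (n : ℝ) ^ r ≤ r.factorial * degOf H T)
    (htPM : (tPM t k l : ℝ) ≤ (α - γ) * (m * r).choose r)
    (b : Fin t → Fin n) (hb : Function.Injective b) (x : Fin t) (v : Fin n) :
    (n : ℝ) * (univ.filter fun π : Equiv.Perm (Fin n) => π (b x) = v ∧
      ¬ HasPM (pullback H (π ∘ b))).card ≤
      2 * (t.choose l * Real.exp (-(m * (γ ^ 2 / 2)))) * n.factorial := by
  have h1 := card_bad_injections_le hk hlt H hH hα hγ hdeg htPM x v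
  have h2 : (univ.filter fun π : Equiv.Perm (Fin n) => π (b x) = v ∧
      ¬ HasPM (pullback H (π ∘ b))).card ≤ (n - t).factorial *
      (univ.filter fun h : Fin t → Fin n => h x = v ∧ Function.Injective h ∧
      ¬ HasPM (pullback H h)).card := by
    refine card_le_mul_card_image_of_maps_to (f := fun π : Equiv.Perm (Fin n) => ⇑π ∘ b)
      (fun π hπ => ?_) _ fun h _ => ?_
    · obtain ⟨h3, h4⟩ := (mem_filter.1 hπ).2
      exact mem_filter.2 ⟨mem_univ _, h3, π.injective.comp hb, h4⟩
    · exact (card_le_card (filter_subset_filter _ (filter_subset _ _))).trans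
        (card_perms_comp_eq_le b hb h)
  have h3 : (n : ℝ) ^ t * (n - t).factorial ≤ 2 * n.factorial := by
    have h4 : n ^ t * (n - t).factorial ≤ 2 * n.factorial := by
      have htn' : t ≤ n := by nlinarith
      rw [← Nat.factorial_mul_descFactorial htn']
      nlinarith [Nat.mul_le_mul_right (n - t).factorial (pow_le_two_mul_descFactorial htn hn)]
    exact_mod_cast h4
  have h2' : ((univ.filter fun π : Equiv.Perm (Fin n) => π (b x) = v ∧
      ¬ HasPM (pullback H (π ∘ b))).card : ℝ) ≤ (n - t).factorial *
      (univ.filter fun h : Fin t → Fin n => h x = v ∧ Function.Injective h ∧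
      ¬ HasPM (pullback H h)).card := by exact_mod_cast h2
  set B := (univ.filter fun π : Equiv.Perm (Fin n) => π (b x) = v ∧
      ¬ HasPM (pullback H (π ∘ b))).card
  set D := (univ.filter fun h : Fin t → Fin n => h x = v ∧ Function.Injective h ∧
      ¬ HasPM (pullback H h)).card
  calc (n : ℝ) * B ≤ n * ((n - t).factorial * D) := by gcongr
    _ = (n - t).factorial * (n * D) := by ring
    _ ≤ (n - t).factorial * (t.choose l * (Real.exp (-(m * (γ ^ 2 / 2))) * (n : ℝ) ^ t)) := by
        gcongr
    _ = (t.choose l * Real.exp (-(m * (γ ^ 2 / 2)))) * ((n : ℝ) ^ t * (n - t).factorial) := by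
        ring
    _ ≤ (t.choose l * Real.exp (-(m * (γ ^ 2 / 2)))) * (2 * n.factorial) := by gcongr
    _ = _ := by ring

end BlockPermutations

section SpreadMatchings

open Filter Topology

lemma eventually_mul_pow_le {a b : ℝ} (hab : a < b) (K r : ℕ) :
    ∀ᶠ s : ℕ in atTop, a * (s : ℝ) ^ r ≤ b * ((s - K : ℕ) : ℝ) ^ r := by
  have h1 : Tendsto (fun s : ℕ => b * (1 - (K : ℝ) / s) ^ r) atTop (𝓝 (b * (1 - 0) ^ r)) :=
    ((tendsto_const_nhds.sub (tendsto_const_div_atTop_nhds_zero_nat (K : ℝ))).pow r).const_mul b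
  rw [sub_zero, one_pow, mul_one] at h1
  filter_upwards [h1.eventually (lt_mem_nhds hab), eventually_gt_atTop K] with s hs hsK
  have hs0 : (0 : ℝ) < s := by exact_mod_cast (by omega : 0 < s)
  rw [Nat.cast_sub hsK.le]
  have h2 : ((s : ℝ) - K) = (1 - (K : ℝ) / s) * s := by field_simp
  rw [h2, mul_pow, ← mul_assoc]
  exact mul_le_mul_of_nonneg_right hs.le (by positivity)

lemma eventually_mul_pow_mul_exp_le {c : ℝ} (hc : 0 < c) (A K : ℝ) (l : ℕ) :
    ∀ᶠ t : ℕ in atTop, A * (2 * (t : ℝ)) ^ l * Real.exp (-(c * (t - K))) ≤ 1 := by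
  have h1 : Tendsto (fun x : ℝ => x ^ l * Real.exp (-x)) atTop (𝓝 0) :=
    Real.tendsto_pow_mul_exp_neg_atTop_nhds_zero l
  have h2 : Tendsto (fun t : ℕ => c * (t : ℝ)) atTop atTop :=
    tendsto_natCast_atTop_atTop.const_mul_atTop hc
  have h3 := (h1.comp h2).const_mul (A * (2 / c) ^ l * Real.exp (c * K))
  rw [mul_zero] at h3
  filter_upwards [h3.eventually (gt_mem_nhds one_pos)] with t ht
  refine le_trans (le_of_eq ?_) ht.le
  have h4 : Real.exp (-(c * (t - K))) = Real.exp (c * K) * Real.exp (-(c * t)) := by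
    rw [← Real.exp_add]
    congr 1
    ring
  have h5 : (2 * (t : ℝ)) ^ l = (2 / c) ^ l * (c * t) ^ l := by
    rw [← mul_pow]
    congr 1
    field_simp
  simp only [Function.comp]
  rw [h4, h5]
  ring

lemma exists_blocks {n t k : ℕ} (ht : 0 < t) (htn : t ≤ n) (hkt : k ∣ t) (hkn : k ∣ n) :
    ∃ blk : Fin n → ℕ, ∀ p, t ≤ (univ.filter fun q => blk q = blk p).card ∧
      (univ.filter fun q => blk q = blk p).card < 2 * t ∧
      k ∣ (univ.filter fun q => blk q = blk p).card := by
  refine ⟨fun q => min (q / t) (n / t - 1), fun p => ?_⟩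
  have hN : 1 ≤ n / t := (Nat.one_le_div_iff ht).2 htn
  have hdm := Nat.div_add_mod n t
  have hmod := Nat.mod_lt n ht
  obtain ⟨N, hN'⟩ : ∃ N, n / t = N + 1 := ⟨n / t - 1, by omega⟩
  rw [hN', Nat.add_sub_cancel]
  rw [hN', mul_add, mul_one, mul_comm t N] at hdm
  dsimp only
  have hcard : ∀ j lo hi : ℕ, hi ≤ n → (∀ q < n, min (q / t) N = j ↔ lo ≤ q ∧ q < hi) →
      (univ.filter fun q : Fin n => min ((q : ℕ) / t) N = j).card = hi - lo := by
    intro j lo hi hhi h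
    rw [← Nat.card_Ico, ← card_map Fin.valEmbedding]
    congr 1
    ext q
    simp only [Finset.mem_map, mem_filter, mem_univ, true_and, Fin.valEmbedding_apply, mem_Ico]
    constructor
    · rintro ⟨q, hq, rfl⟩
      exact (h q q.2).1 hq
    · intro hq
      exact ⟨⟨q, by omega⟩, (h q (by omega)).2 hq, rfl⟩
  have hle : min ((p : ℕ) / t) N ≤ N := min_le_right _ _
  suffices key : ∀ j ≤ N, t ≤ (univ.filter fun q : Fin n => min ((q : ℕ) / t) N = j).card ∧
      (univ.filter fun q : Fin n => min ((q : ℕ) / t) N = j).card < 2 * t ∧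
      k ∣ (univ.filter fun q : Fin n => min ((q : ℕ) / t) N = j).card from key _ hle
  intro j hle
  rcases hle.lt_or_eq with hj | rfl
  · have hjt : (j + 1) * t ≤ N * t := Nat.mul_le_mul_right t hj
    have hNt : N * t ≤ n := by omega
    rw [hcard j (j * t) ((j + 1) * t) (by omega) fun q _ => ?_]
    · have : (j + 1) * t - j * t = t := by rw [add_mul, one_mul, Nat.add_sub_cancel_left]
      rw [this]
      exact ⟨le_rfl, by omega, hkt⟩
    · have h1 := Nat.le_div_iff_mul_le ht (x := j) (y := q)
      have h2 := Nat.div_lt_iff_lt_mul ht (x := q) (y := j + 1)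
      omega
  · have h3 : n - j * t = t + n % t := by omega
    rw [hcard j (j * t) n le_rfl fun q hq => ?_]
    · refine ⟨by omega, by omega, ?_⟩
      exact Nat.dvd_sub hkn (hkt.mul_left j)
    · have h1 := Nat.le_div_iff_mul_le ht (x := j) (y := q)
      omega

/-- The vertices with label `j`. -/
noncomputable def block {n : ℕ} (blk : Fin n → ℕ) (j : ℕ) : Finset (Fin n) :=
  univ.filter fun q => blk q = j

/-- An enumeration of the vertices with label `j`. -/
noncomputable def enumBlock {n : ℕ} (blk : Fin n → ℕ) (j : ℕ) (y : Fin (block blk j).card) :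
    Fin n :=
  (block blk j).equivFin.symm y

lemma blk_enumBlock {n : ℕ} (blk : Fin n → ℕ) (j : ℕ) (y : Fin (block blk j).card) :
    blk (enumBlock blk j y) = j :=
  (mem_filter.1 ((block blk j).equivFin.symm y).2).2

lemma enumBlock_injective {n : ℕ} (blk : Fin n → ℕ) (j : ℕ) :
    Function.Injective (enumBlock blk j) :=
  Subtype.val_injective.comp (Equiv.injective _)

lemma exists_enumBlock_eq {n : ℕ} (blk : Fin n → ℕ) (p : Fin n) :
    ∃ y, enumBlock blk (blk p) y = p :=
  ⟨(block blk (blk p)).equivFin ⟨p, mem_filter.2 ⟨mem_univ _, rfl⟩⟩, by simp [enumBlock]⟩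

lemma hasPM_of_blocks {n : ℕ} (H : Finset (Finset (Fin n))) (blk : Fin n → ℕ)
    (π : Equiv.Perm (Fin n))
    (h : ∀ p, HasPM (pullback H (π ∘ enumBlock blk (blk p)))) :
    ∃ M ⊆ H, (∀ E₁ ∈ M, ∀ E₂ ∈ M, E₁ ≠ E₂ → Disjoint E₁ E₂) ∧ (∀ v : Fin n, ∃ E ∈ M, v ∈ E) ∧
      ∀ E ∈ M, ∀ u ∈ E, ∀ v ∈ E, blk (π.symm u) = blk (π.symm v) := by
  have h1 : ∀ j, ∃ N : Finset (Finset (Fin (block blk j).card)), (∃ p, blk p = j) →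
      N ⊆ pullback H (π ∘ enumBlock blk j) ∧
      (∀ E₁ ∈ N, ∀ E₂ ∈ N, E₁ ≠ E₂ → Disjoint E₁ E₂) ∧ ∀ v, ∃ E ∈ N, v ∈ E := by
    intro j
    by_cases hj : ∃ p, blk p = j
    · obtain ⟨p, rfl⟩ := hj
      obtain ⟨N, hN⟩ := h p
      exact ⟨N, fun _ => hN⟩
    · exact ⟨∅, fun h => absurd h hj⟩
  choose N hN using h1
  have hmem : ∀ (j : ℕ) (E' : Finset (Fin (block blk j).card)),
      ∀ u ∈ E'.image (π ∘ enumBlock blk j), ∃ y ∈ E', π.symm u = enumBlock blk j y := by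
    intro j E' u hu
    obtain ⟨y, hy, rfl⟩ := mem_image.1 hu
    exact ⟨y, hy, by simp⟩
  refine ⟨univ.filter fun E => ∃ j, (∃ p, blk p = j) ∧
    ∃ E' ∈ N j, E'.image (π ∘ enumBlock blk j) = E, ?_, ?_, ?_, ?_⟩
  · intro E hE
    obtain ⟨j, hj, E', hE', rfl⟩ := (mem_filter.1 hE).2
    exact mem_pullback.1 ((hN j hj).1 hE')
  · intro E₁ hE₁ E₂ hE₂
    contrapose!
    obtain ⟨j, hj, E₁', hE₁', rfl⟩ := (mem_filter.1 hE₁).2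
    obtain ⟨j', -, E₂', hE₂', rfl⟩ := (mem_filter.1 hE₂).2
    intro hdis
    obtain ⟨u, hu₁, hu₂⟩ := not_disjoint_iff.1 hdis
    obtain ⟨y, hy, hyu⟩ := hmem j E₁' u hu₁
    obtain ⟨y', hy', hyu'⟩ := hmem j' E₂' u hu₂
    obtain rfl : j = j' := by
      rw [← blk_enumBlock blk j y, ← hyu, hyu', blk_enumBlock blk j' y']
    obtain rfl : y = y' := enumBlock_injective blk j (hyu.symm.trans hyu')
    by_contra hne
    exact disjoint_left.1 ((hN j hj).2.1 E₁' hE₁' E₂' hE₂' fun h => hne (by rw [h])) hy hy'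
  · intro v
    obtain ⟨y, hy⟩ := exists_enumBlock_eq blk (π.symm v)
    obtain ⟨E', hE', hyE'⟩ := (hN _ ⟨π.symm v, rfl⟩).2.2 y
    refine ⟨E'.image (π ∘ enumBlock blk (blk (π.symm v))),
      mem_filter.2 ⟨mem_univ _, _, ⟨π.symm v, rfl⟩, E', hE', rfl⟩, mem_image.2 ⟨y, hyE', ?_⟩⟩
    simp [hy]
  · intro E hE u hu v hv
    obtain ⟨j, -, E', -, rfl⟩ := (mem_filter.1 hE).2
    obtain ⟨y, -, hyu⟩ := hmem j E' u hu
    obtain ⟨y', -, hyv⟩ := hmem j E' v hv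
    rw [hyu, hyv, blk_enumBlock blk j y, blk_enumBlock blk j y']

lemma exists_spread_matchings (k l : ℕ) (hl : 1 ≤ l) (hlk : l < k)
    (ε : ℝ) (hε : 0 < ε) (dirac : ℝ)
    (hdirac : Tendsto
      (fun m : ℕ => (tPM (k * m) k l : ℝ) / (Nat.choose (k * m) (k - l) : ℝ)) atTop (𝓝 dirac)) :
    ∃ w : ℕ, 0 < w ∧ ∃ n₀ : ℕ, ∀ n : ℕ, n₀ ≤ n → k ∣ n →
      ∀ H : Finset (Finset (Fin n)), (∀ E ∈ H, E.card = k) →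
        (∀ T : Finset (Fin n), T.card = l →
          (dirac + ε) * (Nat.choose (n - l) (k - l) : ℝ) ≤ (degOf H T : ℝ)) →
      ∃ blk : Fin n → ℕ, (∀ p, (block blk (blk p)).card ≤ w) ∧
      ∃ G : Finset (Equiv.Perm (Fin n)), G.Nonempty ∧
      (∀ π ∈ G, ∃ M ⊆ H, (∀ E₁ ∈ M, ∀ E₂ ∈ M, E₁ ≠ E₂ → Disjoint E₁ E₂) ∧
        (∀ v : Fin n, ∃ E ∈ M, v ∈ E) ∧
        ∀ E ∈ M, ∀ u ∈ E, ∀ v ∈ E, blk (π.symm u) = blk (π.symm v)) ∧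
      ∀ M : Finset (Fin n × Fin n), ((G ∩ extending M).card : ℝ) * (n : ℝ) ^ M.card ≤
        Real.exp 2 ^ M.card * G.card := by
  obtain ⟨r, rfl⟩ : ∃ r, k = l + r := ⟨k - l, by omega⟩
  have hr : 1 ≤ r := by omega
  rw [Nat.add_sub_cancel_left] at hdirac
  set k := l + r with hk
  have hd0 : 0 ≤ dirac := ge_of_tendsto' hdirac fun m => by positivity
  have hr0 : (0 : ℝ) < r := by exact_mod_cast hr
  -- choice of the block size
  have e1 : ∀ᶠ m : ℕ in atTop, (tPM (k * m) k l : ℝ) / (Nat.choose (k * m) r : ℝ) <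
      dirac + ε / 4 := hdirac.eventually (gt_mem_nhds (by linarith))
  obtain ⟨m₁, hm₁⟩ := eventually_atTop.1 e1
  obtain ⟨t₂, ht₂⟩ := eventually_atTop.1 (eventually_mul_pow_le
    (a := dirac + ε / 4) (b := dirac + ε / 2) (by linarith) (2 * k) r)
  obtain ⟨t₃, ht₃⟩ := eventually_atTop.1 (eventually_mul_pow_mul_exp_le
    (c := (1 / r) * ((ε / 4) ^ 2 / 2)) (by positivity) 32 k (l + 1))
  obtain ⟨t₄, ht₄⟩ := eventually_atTop.1 (eventually_mul_pow_le
    (a := dirac + 3 * ε / 4) (b := dirac + ε) (by linarith) (2 * k) r)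
  set t := k * (m₁ + t₂ + t₃ + 2) with ht
  have htk : 2 * k ≤ t := by rw [ht]; nlinarith
  have htm : m₁ + t₂ + t₃ + 2 ≤ t := by
    rw [ht]; exact Nat.le_mul_of_pos_left _ (by omega)
  refine ⟨2 * t, by omega, t₄ + 2 * (2 * t) ^ 2 + 2 * t + 1, fun n hn hkn H hH hdeg => ?_⟩
  have hn0 : 0 < n := by omega
  obtain ⟨blk, hblk⟩ := exists_blocks (n := n) (t := t) (k := k) (by omega) (by omega)
    (Dvd.intro _ rfl) hkn
  have hα : ∀ T : Finset (Fin n), T.card = l →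
      (dirac + 3 * ε / 4) * (n : ℝ) ^ r ≤ r.factorial * degOf H T := by
    intro T hT
    have h1 := hdeg T hT
    rw [hk, Nat.add_sub_cancel_left] at h1
    have h2 := Nat.pow_le_choose (α := ℝ) r (n - l)
    rw [div_le_iff₀ (by positivity)] at h2
    have h3 : ((n - 2 * k : ℕ) : ℝ) ^ r ≤ ((n - l + 1 - r : ℕ) : ℝ) ^ r := by
      refine pow_le_pow_left₀ (Nat.cast_nonneg _) ?_ r
      exact_mod_cast (by omega : n - 2 * k ≤ n - l + 1 - r)
    have h4 := ht₄ n (by omega)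
    have h5 : (0 : ℝ) < dirac + ε := by linarith
    calc _ ≤ (dirac + ε) * ((n - 2 * k : ℕ) : ℝ) ^ r := h4
      _ ≤ (dirac + ε) * (((n - l).choose r : ℝ) * r.factorial) := by
        gcongr
        exact h3.trans h2
      _ = r.factorial * ((dirac + ε) * (n - l).choose r) := by ring
      _ ≤ _ := by gcongr
  refine ⟨blk, fun p => (hblk p).2.1.le, ?_⟩
  have hspread := exists_spread_perms blk (2 * t) (by omega) (fun p => (hblk p).2.1.le)
    (fun j π => ¬ HasPM (pullback H (π ∘ enumBlock blk j))) ?_ ?_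
  · obtain ⟨G, hG, hGH, hGs⟩ := hspread
    rw [Fintype.card_fin] at hGs
    exact ⟨G, hG, fun π hπ => hasPM_of_blocks H blk π fun p => not_not.1 (hGH π hπ p), hGs⟩
  · intro j π π' h
    have : π ∘ enumBlock blk j = π' ∘ enumBlock blk j := funext fun y =>
      h _ (blk_enumBlock blk j y)
    rw [this]
    exact id
  · intro p v
    have hmain : ∀ (s : ℕ) (b : Fin s → Fin n), Function.Injective b → t ≤ s → s < 2 * t →
        k ∣ s → ∀ x, 16 * (2 * t) * n *
          (univ.filter fun π : Equiv.Perm (Fin n) =>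
            π (b x) = v ∧ ¬ HasPM (pullback H (π ∘ b))).card ≤ n.factorial := by
      rintro s b hb hs1 hs2 ⟨m', hs⟩ x
      have hm' : m₁ ≤ m' := by
        have h1 : m₁ + t₂ + t₃ + 2 ≤ m' := Nat.le_of_mul_le_mul_left (hs ▸ hs1) (by omega)
        omega
      obtain ⟨m, hm⟩ : ∃ m, m = (s - l - 1) / r := ⟨_, rfl⟩
      have hmr1 : m * r ≤ s - l - 1 := hm ▸ Nat.div_mul_le_self _ _
      have hmr2 : s - k ≤ m * r := by
        have h1 := Nat.div_add_mod (s - l - 1) r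
        have h2 := Nat.mod_lt (s - l - 1) (show r > 0 by omega)
        rw [← hm, mul_comm] at h1
        omega
      have hchoose : (0 : ℝ) < s.choose r := by
        exact_mod_cast Nat.choose_pos (by omega)
      have htPM : (tPM s k l : ℝ) ≤ ((dirac + 3 * ε / 4) - ε / 4) * (m * r).choose r := by
        have h1 := hm₁ m' hm'
        rw [← hs, div_lt_iff₀ hchoose] at h1
        have h2 : (s.choose r : ℝ) ≤ (s : ℝ) ^ r / r.factorial := Nat.choose_le_pow_div r s
        have h3 := ht₂ s (by omega)
        have h4 := Nat.pow_le_choose (α := ℝ) r (m * r)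
        have h5 : ((s - 2 * k : ℕ) : ℝ) ^ r ≤ ((m * r + 1 - r : ℕ) : ℝ) ^ r := by
          refine pow_le_pow_left₀ (Nat.cast_nonneg _) ?_ r
          exact_mod_cast (by omega : s - 2 * k ≤ m * r + 1 - r)
        have h6 : dirac + 3 * ε / 4 - ε / 4 = dirac + ε / 2 := by ring
        rw [h6]
        calc (tPM s k l : ℝ) ≤ (dirac + ε / 4) * s.choose r := h1.le
          _ ≤ (dirac + ε / 4) * ((s : ℝ) ^ r / r.factorial) := by gcongr
          _ = ((dirac + ε / 4) * (s : ℝ) ^ r) / r.factorial := by ring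
          _ ≤ ((dirac + ε / 2) * ((m * r + 1 - r : ℕ) : ℝ) ^ r) / r.factorial := by
            refine div_le_div_of_nonneg_right ?_ (by positivity)
            exact h3.trans (mul_le_mul_of_nonneg_left h5 (by positivity))
          _ = (dirac + ε / 2) * (((m * r + 1 - r : ℕ) : ℝ) ^ r / r.factorial) := by ring
          _ ≤ _ := by gcongr
      have hsn : 2 * s ^ 2 ≤ n := by
        have : s ^ 2 ≤ (2 * t) ^ 2 := Nat.pow_le_pow_left hs2.le 2
        omega
      have hbad := card_bad_perms_le hk (by omega) hsn hn0 H hH (by positivity) (by positivity)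
        hα htPM b hb x v
      have hexp : Real.exp (-(m * ((ε / 4) ^ 2 / 2))) ≤
          Real.exp (-(1 / r * ((ε / 4) ^ 2 / 2) * (t - k))) := by
        rw [Real.exp_le_exp, neg_le_neg_iff]
        have h1 : (t : ℝ) - k ≤ m * r := by
          rw [← Nat.cast_sub (by omega)]
          exact_mod_cast (by omega : t - k ≤ m * r)
        calc 1 / r * ((ε / 4) ^ 2 / 2) * ((t : ℝ) - k)
            ≤ 1 / r * ((ε / 4) ^ 2 / 2) * (m * r) := by gcongr
          _ = _ := by field_simp
      have hsl : (s.choose l : ℝ) ≤ (2 * (t : ℝ)) ^ l := by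
        have h1 : s.choose l ≤ s ^ l := Nat.choose_le_pow s l
        have h2 : s ^ l ≤ (2 * t) ^ l := Nat.pow_le_pow_left hs2.le l
        exact_mod_cast h1.trans h2
      have h1 := ht₃ t (by omega)
      refine Nat.cast_le (α := ℝ).1 ?_
      push_cast
      set N := (univ.filter fun π : Equiv.Perm (Fin n) =>
            π (b x) = v ∧ ¬ HasPM (pullback H (π ∘ b))).card
      calc 16 * (2 * (t : ℝ)) * n * N = 16 * (2 * t) * (n * N) := by ring
        _ ≤ 16 * (2 * t) * (2 * (s.choose l * Real.exp (-(m * ((ε / 4) ^ 2 / 2)))) *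
            n.factorial) := by gcongr
        _ ≤ 16 * (2 * t) * (2 * ((2 * (t : ℝ)) ^ l *
            Real.exp (-(1 / r * ((ε / 4) ^ 2 / 2) * (t - k)))) * n.factorial) := by gcongr
        _ = (32 * (2 * (t : ℝ)) ^ (l + 1) *
            Real.exp (-(1 / r * ((ε / 4) ^ 2 / 2) * (t - k)))) * n.factorial := by ring
        _ ≤ 1 * n.factorial := by gcongr
        _ = _ := one_mul _
    obtain ⟨x, hx⟩ := exists_enumBlock_eq blk p
    obtain ⟨hs1, hs2, hs3⟩ : t ≤ (block blk (blk p)).card ∧ (block blk (blk p)).card < 2 * t ∧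
      k ∣ (block blk (blk p)).card := hblk p
    have h := hmain _ _ (enumBlock_injective blk (blk p)) hs1 hs2 hs3 x
    rw [hx] at h
    rw [Fintype.card_perm, Fintype.card_fin]
    convert h using 2
    congr

end SpreadMatchings

section Transfer

variable {n : ℕ}

lemma card_mul_pow_le_of_blocks {k w : ℕ} (hk : 1 ≤ k) (hn : 0 < n) (blk : Fin n → ℕ)
    (hw : ∀ p, (block blk (blk p)).card ≤ w) (G : Finset (Equiv.Perm (Fin n)))
    (hG : ∀ M : Finset (Fin n × Fin n), ((G ∩ extending M).card : ℝ) * (n : ℝ) ^ M.card ≤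
      Real.exp 2 ^ M.card * G.card)
    (A : Finset (Finset (Fin n))) (hA : ∀ E ∈ A, E.card = k)
    (hdis : ∀ E₁ ∈ A, ∀ E₂ ∈ A, E₁ ≠ E₂ → Disjoint E₁ E₂) (Q : Equiv.Perm (Fin n) → Prop)
    [DecidablePred Q]
    (hQ : ∀ π, Q π → ∀ E ∈ A, ∀ u ∈ E, ∀ v ∈ E, blk (π.symm u) = blk (π.symm v)) :
    ((G.filter Q).card : ℝ) * ((n : ℝ) ^ (k - 1)) ^ A.card ≤
      ((w : ℝ) ^ (k - 1) * Real.exp 2 ^ k) ^ A.card * G.card := by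
  have hne : ∀ E ∈ A, ∃ v, v ∈ E := fun E hE => card_pos.1 (by rw [hA E hE]; omega)
  obtain ⟨rep, hrep⟩ : ∃ rep : Finset (Fin n) → Fin n, ∀ E ∈ A, rep E ∈ E := by
    refine ⟨fun E => if h : E ∈ A then (hne E h).choose else ⟨0, hn⟩, fun E hE => ?_⟩
    simp only [hE, dif_pos]
    exact (hne E hE).choose_spec
  set W := A.biUnion (fun E => E) with hW
  have hWcard : W.card = k * A.card := by
    rw [hW, card_biUnion hdis, sum_congr rfl hA, sum_const, smul_eq_mul, mul_comm]
  obtain ⟨edge, hedge⟩ : ∃ edge : Fin n → Finset (Fin n), ∀ u ∈ W, edge u ∈ A ∧ u ∈ edge u := by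
    refine ⟨fun u => if h : ∃ E ∈ A, u ∈ E then h.choose else ∅, fun u hu => ?_⟩
    have h : ∃ E ∈ A, u ∈ E := by simpa [hW] using hu
    simp only [h, dif_pos]
    exact h.choose_spec
  set R := A.image rep with hR
  have hRW : R ⊆ W := by
    intro u hu
    obtain ⟨E, hE, rfl⟩ := mem_image.1 hu
    exact mem_biUnion.2 ⟨E, hE, hrep E hE⟩
  have hRcard : R.card = A.card := by
    refine card_image_of_injOn fun E hE E' hE' h => ?_
    by_contra hne
    refine disjoint_left.1 (hdis E hE E' hE' hne) (hrep E hE) ?_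
    rw [h]
    exact hrep E' hE'
  set pat : Equiv.Perm (Fin n) → Fin n → Fin n := fun π u => if u ∈ W then π.symm u else u
    with hpat
  set P : Finset (Fin n → Fin n) :=
    (Fintype.piFinset fun u : Fin n => if u ∈ R then univ else {u}).biUnion fun h =>
      Fintype.piFinset fun u : Fin n => if u ∈ R then {h u} else
        if u ∈ W then block blk (blk (h (rep (edge u)))) else {u} with hP
  have hmem : ∀ π, Q π → pat π ∈ P := by
    intro π hπ
    refine mem_biUnion.2 ⟨fun u => if u ∈ R then π.symm u else u, ?_, ?_⟩
    · refine Fintype.mem_piFinset.2 fun u => ?_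
      split_ifs <;> simp
    · refine Fintype.mem_piFinset.2 fun u => ?_
      simp only [hpat]
      by_cases huR : u ∈ R
      · simp [huR, hRW huR]
      · by_cases huW : u ∈ W
        · obtain ⟨h1, h2⟩ := hedge u huW
          have h3 : rep (edge u) ∈ R := mem_image_of_mem _ h1
          simp only [huR, huW, h3, if_true, if_false]
          exact mem_filter.2 ⟨mem_univ _, hQ π hπ _ h1 _ h2 _ (hrep _ h1)⟩
        · simp [huR, huW]
  have hPcard : P.card ≤ n ^ A.card * w ^ ((k - 1) * A.card) := by
    have h1 : ∀ h : Fin n → Fin n, (Fintype.piFinset fun u : Fin n => if u ∈ R then {h u} else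
        if u ∈ W then block blk (blk (h (rep (edge u)))) else {u}).card ≤
        w ^ ((k - 1) * A.card) := by
      intro h
      rw [Fintype.card_piFinset]
      have h2 : ((k - 1) * A.card) = (W \ R).card := by
        rw [card_sdiff_of_subset hRW, hWcard, hRcard, Nat.sub_mul, one_mul]
      rw [h2, ← prod_const, ← Fintype.prod_ite_mem (W \ R)]
      refine prod_le_prod' fun u _ => ?_
      by_cases huR : u ∈ R
      · simp [huR]
      · by_cases huW : u ∈ W
        · simp only [huR, huW, if_true, if_false, mem_sdiff, not_false_eq_true, and_self]
          exact hw _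
        · simp [huR, huW]
    refine card_biUnion_le_card_mul _ _ _ (fun h _ => h1 h) |>.trans ?_
    refine Nat.mul_le_mul_right _ ?_
    rw [Fintype.card_piFinset, ← hRcard, ← prod_const, ← Fintype.prod_ite_mem R]
    refine prod_le_prod' fun u _ => ?_
    split_ifs <;> simp
  have hfib : ∀ g : Fin n → Fin n, (((G.filter Q).filter fun π => pat π = g).card : ℝ) *
      (n : ℝ) ^ (k * A.card) ≤ Real.exp 2 ^ (k * A.card) * G.card := by
    intro g
    set N : Finset (Fin n × Fin n) := W.image fun u => (g u, u)
    have hN : N.card = k * A.card := by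
      rw [← hWcard]
      exact card_image_of_injective _ fun u v h => (Prod.mk.inj h).2
    refine le_trans ?_ (hN ▸ hG N)
    gcongr
    intro π hπ
    obtain ⟨h1, h2⟩ := mem_filter.1 hπ
    refine mem_inter.2 ⟨(mem_filter.1 h1).1, mem_extending.2 fun x hx => ?_⟩
    obtain ⟨u, hu, rfl⟩ := mem_image.1 hx
    simp [← h2, hpat, hu]
  have hsum : ((G.filter Q).card : ℝ) * (n : ℝ) ^ (k * A.card) ≤
      P.card * (Real.exp 2 ^ (k * A.card) * G.card) := by
    rw [card_eq_sum_card_fiberwise (f := pat) (t := P) fun π hπ =>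
      hmem π (mem_filter.1 (mem_coe.1 hπ)).2]
    push_cast
    rw [sum_mul, ← nsmul_eq_mul]
    exact sum_le_card_nsmul _ _ _ fun g _ => hfib g
  have hn' : (0 : ℝ) < (n : ℝ) ^ A.card := by positivity
  refine le_of_mul_le_mul_right ?_ hn'
  have h1 : ((n : ℝ) ^ (k - 1)) ^ A.card * (n : ℝ) ^ A.card = (n : ℝ) ^ (k * A.card) := by
    rw [← mul_pow, ← pow_succ, Nat.sub_add_cancel hk, pow_mul]
  have hPcard' : (P.card : ℝ) ≤ (n : ℝ) ^ A.card * (w : ℝ) ^ ((k - 1) * A.card) := by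
    exact_mod_cast hPcard
  calc _ = ((G.filter Q).card : ℝ) * (n : ℝ) ^ (k * A.card) := by rw [mul_assoc, h1]
    _ ≤ P.card * (Real.exp 2 ^ (k * A.card) * G.card) := hsum
    _ ≤ ((n : ℝ) ^ A.card * (w : ℝ) ^ ((k - 1) * A.card)) *
        (Real.exp 2 ^ (k * A.card) * G.card) := by gcongr
    _ = _ := by
      rw [mul_pow, ← pow_mul, ← pow_mul]
      ring

/-- The edges of `M` coloured by `σ ∘ ι`. -/
def colouredEdges {E C : Type*} [DecidableEq E] [DecidableEq C] (M : Finset E) (ι : E → C)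
    (σ : Equiv.Perm C) : Finset (E × C) :=
  M.image fun e => (e, σ (ι e))

lemma card_perms_subset_colouredEdges_le {E C : Type*} [DecidableEq E] [DecidableEq C] [Fintype C]
    {M : Finset E} {ι : E → C} (hι : Set.InjOn ι M) (T : Finset (E × C)) :
    ((univ.filter fun σ : Equiv.Perm C => T ⊆ colouredEdges M ι σ).card : ℝ) *
      (Fintype.card C : ℝ) ^ T.card ≤ Real.exp 1 ^ T.card * Fintype.card (Equiv.Perm C) := by
  rcases (univ.filter fun σ : Equiv.Perm C => T ⊆ colouredEdges M ι σ).eq_empty_or_nonempty with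
    h0 | ⟨τ, hτ⟩
  · rw [h0, card_empty, Nat.cast_zero, zero_mul]
    positivity
  · have hτ := (mem_filter.1 hτ).2
    set N : Finset (C × C) := T.image fun x => (ι x.1, x.2)
    have hN : N.card = T.card := by
      refine card_image_of_injOn fun x hx y hy hxy => ?_
      obtain ⟨e, he, rfl⟩ := mem_image.1 (hτ hx)
      obtain ⟨e', he', rfl⟩ := mem_image.1 (hτ hy)
      rw [hι he he' (Prod.mk.inj hxy).1]
    rw [← hN]
    refine le_trans ?_ (card_extending_mul_pow_le N)
    gcongr
    intro σ hσ
    refine mem_extending.2 fun x hx => ?_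
    obtain ⟨y, hy, rfl⟩ := mem_image.1 hx
    obtain ⟨e, he, rfl⟩ := mem_image.1 ((mem_filter.1 hσ).2 hy)
    rfl

end Transfer

section Transfer

variable {n : ℕ}

lemma card_pairs_subset_colouredEdges_le {k w qc : ℕ} (hk : 1 ≤ k) (hn : 0 < n) (blk : Fin n → ℕ)
    (hw0 : 0 < w)
    (hw : ∀ p, (block blk (blk p)).card ≤ w) (G : Finset (Equiv.Perm (Fin n)))
    (hG : ∀ M : Finset (Fin n × Fin n), ((G ∩ extending M).card : ℝ) * (n : ℝ) ^ M.card ≤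
      Real.exp 2 ^ M.card * G.card)
    (M : Equiv.Perm (Fin n) → Finset (Finset (Fin n)))
    (hM : ∀ π ∈ G, ∀ E ∈ M π, E.card = k)
    (hdis : ∀ π ∈ G, ∀ E₁ ∈ M π, ∀ E₂ ∈ M π, E₁ ≠ E₂ → Disjoint E₁ E₂)
    (hblk : ∀ π ∈ G, ∀ E ∈ M π, ∀ u ∈ E, ∀ v ∈ E, blk (π.symm u) = blk (π.symm v))
    (ι : Equiv.Perm (Fin n) → Finset (Fin n) → Fin qc) (hι : ∀ π ∈ G, Set.InjOn (ι π) (M π))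
    (T : Finset (Finset (Fin n) × Fin qc)) :
    (((G ×ˢ univ).filter fun x : Equiv.Perm (Fin n) × Equiv.Perm (Fin qc) =>
      T ⊆ colouredEdges (M x.1) (ι x.1) x.2).card : ℝ) * ((n : ℝ) ^ (k - 1) * qc) ^ T.card ≤
      ((w : ℝ) ^ (k - 1) * Real.exp 2 ^ k * Real.exp 1) ^ T.card *
        (G.card * Fintype.card (Equiv.Perm (Fin qc))) := by
  rcases ((G ×ˢ univ).filter fun x : Equiv.Perm (Fin n) × Equiv.Perm (Fin qc) =>
      T ⊆ colouredEdges (M x.1) (ι x.1) x.2).eq_empty_or_nonempty with h0 | ⟨⟨ρ, τ⟩, hτ⟩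
  · rw [h0, card_empty, Nat.cast_zero, zero_mul]
    positivity
  obtain ⟨hρ, hρT⟩ := mem_filter.1 hτ
  have hρ := (mem_product.1 hρ).1
  dsimp only at hρ hρT
  set A := T.image Prod.fst with hA
  have hsub : ∀ {π : Equiv.Perm (Fin n)} {σ : Equiv.Perm (Fin qc)},
      T ⊆ colouredEdges (M π) (ι π) σ → A ⊆ M π := by
    intro π σ h E hE
    obtain ⟨x, hx, rfl⟩ := mem_image.1 hE
    obtain ⟨e, he, rfl⟩ := mem_image.1 (h hx)
    exact he
  have hAM : A ⊆ M ρ := hsub hρT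
  have hAT : A.card = T.card := by
    refine card_image_of_injOn fun x hx y hy hxy => ?_
    obtain ⟨e, he, rfl⟩ := mem_image.1 (hρT hx)
    obtain ⟨e', he', rfl⟩ := mem_image.1 (hρT hy)
    dsimp only at hxy
    rw [hxy]
  have h1 := card_mul_pow_le_of_blocks hk hn blk hw G hG A (fun E hE => hM ρ hρ E (hAM hE))
    (fun E₁ hE₁ E₂ hE₂ => hdis ρ hρ E₁ (hAM hE₁) E₂ (hAM hE₂)) (fun π => π ∈ G ∧ A ⊆ M π)
    (fun π hπ E hE => hblk π hπ.1 E (hπ.2 hE))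
  set P := G.filter fun π => π ∈ G ∧ A ⊆ M π
  set Y := (G ×ˢ univ).filter fun x : Equiv.Perm (Fin n) × Equiv.Perm (Fin qc) =>
    T ⊆ colouredEdges (M x.1) (ι x.1) x.2 with hY
  have h2 : (Y.card : ℝ) * (qc : ℝ) ^ T.card ≤
      P.card * (Real.exp 1 ^ T.card * Fintype.card (Equiv.Perm (Fin qc))) := by
    rw [card_eq_sum_card_fiberwise (f := Prod.fst) (t := P) fun x hx => ?_]
    · push_cast
      rw [sum_mul, ← nsmul_eq_mul]
      refine sum_le_card_nsmul _ _ _ fun π hπ => ?_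
      have hπG := (mem_filter.1 hπ).1
      have h3 := card_perms_subset_colouredEdges_le (hι π hπG) T
      rw [Fintype.card_fin] at h3
      refine le_trans ?_ h3
      refine mul_le_mul_of_nonneg_right ?_ (by positivity)
      refine Nat.cast_le.2 (card_le_card_of_injOn Prod.snd (fun x hx => ?_)
        fun x hx y hy hxy => ?_)
      · obtain ⟨h4, rfl⟩ := mem_filter.1 (mem_coe.1 hx)
        exact mem_coe.2 (mem_filter.2 ⟨mem_univ _, (mem_filter.1 h4).2⟩)
      · exact Prod.ext ((mem_filter.1 (mem_coe.1 hx)).2.trans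
          (mem_filter.1 (mem_coe.1 hy)).2.symm) hxy
    · obtain ⟨h4, h5⟩ := mem_filter.1 (mem_coe.1 hx)
      have h6 := (mem_product.1 h4).1
      exact mem_coe.2 (mem_filter.2 ⟨h6, h6, hsub h5⟩)
  rw [hAT] at h1
  calc (Y.card : ℝ) * ((n : ℝ) ^ (k - 1) * qc) ^ T.card
      = (Y.card * (qc : ℝ) ^ T.card) * ((n : ℝ) ^ (k - 1)) ^ T.card := by ring
    _ ≤ (P.card * (Real.exp 1 ^ T.card * Fintype.card (Equiv.Perm (Fin qc)))) *
        ((n : ℝ) ^ (k - 1)) ^ T.card := by gcongr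
    _ = (P.card * ((n : ℝ) ^ (k - 1)) ^ T.card) *
        (Real.exp 1 ^ T.card * Fintype.card (Equiv.Perm (Fin qc))) := by ring
    _ ≤ (((w : ℝ) ^ (k - 1) * Real.exp 2 ^ k) ^ T.card * G.card) *
        (Real.exp 1 ^ T.card * Fintype.card (Equiv.Perm (Fin qc))) := by gcongr
    _ = _ := by ring

/-- A family in which no small set is contained in many members has no cheap cover. -/
lemma one_le_of_hasCover {Ω α : Type*} [DecidableEq α] {I : Finset Ω} (hI : I.Nonempty)
    (S : Ω → Finset α) {p c : ℝ}
    (hS : ∀ T : Finset α, ((I.filter fun x => T ⊆ S x).card : ℝ) ≤ p ^ T.card * I.card)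
    (h : HasCover p (I.image S) c) : 1 ≤ c := by
  obtain ⟨U, hU, hc⟩ := h
  refine le_trans ?_ hc
  have hI0 : (0 : ℝ) < I.card := by exact_mod_cast hI.card_pos
  refine le_of_mul_le_mul_right ?_ hI0
  have h1 : I ⊆ U.biUnion fun T => I.filter fun x => T ⊆ S x := by
    intro x hx
    obtain ⟨T, hT, hTS⟩ := hU (S x) (mem_image_of_mem _ hx)
    exact mem_biUnion.2 ⟨T, hT, mem_filter.2 ⟨hx, hTS⟩⟩
  have h2 : (I.card : ℝ) ≤ ∑ T ∈ U, ((I.filter fun x => T ⊆ S x).card : ℝ) := by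
    exact_mod_cast (card_le_card h1).trans card_biUnion_le
  rw [one_mul, sum_mul]
  exact h2.trans (sum_le_sum fun T _ => hS T)

lemma exists_injOn_fin {α : Type*} {M : Finset α} {q : ℕ} (h : M.card ≤ q) (hq : 0 < q) :
    ∃ f : α → Fin q, Set.InjOn f M := by
  refine ⟨fun x => if hx : x ∈ M then Fin.castLE h (M.equivFin ⟨x, hx⟩) else ⟨0, hq⟩,
    fun x hx y hy hxy => ?_⟩
  have hx' := mem_coe.1 hx
  have hy' := mem_coe.1 hy
  simp only [hx', hy', dif_pos] at hxy
  exact congrArg Subtype.val (M.equivFin.injective (Fin.castLE_injective h hxy))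

lemma card_mul_eq_of_matching {k : ℕ} {M : Finset (Finset (Fin n))} (hM : ∀ E ∈ M, E.card = k)
    (hdis : ∀ E₁ ∈ M, ∀ E₂ ∈ M, E₁ ≠ E₂ → Disjoint E₁ E₂) (hcov : ∀ v : Fin n, ∃ E ∈ M, v ∈ E) :
    M.card * k = n := by
  have h1 : M.biUnion (fun E => E) = univ := eq_univ_of_forall fun v => mem_biUnion.2 (hcov v)
  have h2 := card_biUnion hdis
  rw [h1, card_univ, Fintype.card_fin, sum_congr rfl hM, sum_const, smul_eq_mul] at h2
  exact h2.symm

lemma rainbowPMProb_eq (n qc : ℕ) (p : ℝ) (H : Finset (Finset (Fin n))) :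
    rainbowPMProb n qc p H = bern p H fun R => ((qc : ℝ) ^ Fintype.card (Finset (Fin n)))⁻¹ *
      ∑ c : Finset (Fin n) → Fin qc,
        if ∃ M ⊆ R, (∀ E₁ ∈ M, ∀ E₂ ∈ M, E₁ ≠ E₂ → Disjoint E₁ E₂) ∧
            (∀ v : Fin n, ∃ E ∈ M, v ∈ E) ∧
            (∀ E₁ ∈ M, ∀ E₂ ∈ M, c E₁ = c E₂ → E₁ = E₂)
          then (1 : ℝ) else 0 := by
  unfold rainbowPMProb bern
  refine sum_congr rfl fun R _ => ?_
  rw [← mul_assoc, mul_sum]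

/-- A spread family of perfect matchings of `H` forces rainbow perfect matchings. -/
lemma rainbowPMProb_ge {k w qc : ℕ} (hk : 1 ≤ k) (hn : 0 < n) (hqc : n / k ≤ qc) (hqc0 : 0 < qc)
    (blk : Fin n → ℕ) (hw0 : 0 < w)
    (hw : ∀ p, (block blk (blk p)).card ≤ w) (G : Finset (Equiv.Perm (Fin n))) (hG0 : G.Nonempty)
    (hG : ∀ M : Finset (Fin n × Fin n), ((G ∩ extending M).card : ℝ) * (n : ℝ) ^ M.card ≤
      Real.exp 2 ^ M.card * G.card)
    (H : Finset (Finset (Fin n))) (hH : ∀ E ∈ H, E.card = k)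
    (hGH : ∀ π ∈ G, ∃ M ⊆ H, (∀ E₁ ∈ M, ∀ E₂ ∈ M, E₁ ≠ E₂ → Disjoint E₁ E₂) ∧
        (∀ v : Fin n, ∃ E ∈ M, v ∈ E) ∧
        ∀ E ∈ M, ∀ u ∈ E, ∀ v ∈ E, blk (π.symm u) = blk (π.symm v))
    (a B : ℕ) (ha : 1 ≤ a) (hB : 1 ≤ B) (han : n ≤ 2 ^ a) {p : ℝ} (hp1 : p ≤ 1)
    (hp : 17 * a * ((w : ℝ) ^ (k - 1) * Real.exp 2 ^ k * Real.exp 1) ≤ p * (n : ℝ) ^ (k - 1)) :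
    1 - ((1 / 2) ^ B + ((1 + 1 / (a : ℝ)) ^ B - 1)) ≤ rainbowPMProb n qc p H := by
  have hex : ∀ π : Equiv.Perm (Fin n), ∃ M : Finset (Finset (Fin n)),
      ∃ ι : Finset (Fin n) → Fin qc, π ∈ G → M ⊆ H ∧
        (∀ E₁ ∈ M, ∀ E₂ ∈ M, E₁ ≠ E₂ → Disjoint E₁ E₂) ∧
        (∀ v : Fin n, ∃ E ∈ M, v ∈ E) ∧
        (∀ E ∈ M, ∀ u ∈ E, ∀ v ∈ E, blk (π.symm u) = blk (π.symm v)) ∧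
        M.card ≤ n ∧ Set.InjOn ι M := by
    intro π
    by_cases hπ : π ∈ G
    · obtain ⟨M, hMH, h1, h2, h3⟩ := hGH π hπ
      have h4 := card_mul_eq_of_matching (fun E hE => hH E (hMH hE)) h1 h2
      have h5 : M.card = n / k := (Nat.div_eq_of_eq_mul_left (by omega) h4.symm).symm
      obtain ⟨ι, hι⟩ := exists_injOn_fin (h5.trans_le hqc) hqc0
      exact ⟨M, ι, fun _ => ⟨hMH, h1, h2, h3, h5.trans_le (Nat.div_le_self _ _), hι⟩⟩
    · exact ⟨∅, fun _ => ⟨0, hqc0⟩, fun h => absurd h hπ⟩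
  choose M ι hMι using hex
  set K : ℝ := (w : ℝ) ^ (k - 1) * Real.exp 2 ^ k * Real.exp 1 with hK
  have hw0' : (0 : ℝ) < w := by exact_mod_cast hw0
  have hn' : (0 : ℝ) < n := by exact_mod_cast hn
  have hqc' : (0 : ℝ) < qc := by exact_mod_cast hqc0
  have ha' : (1 : ℝ) ≤ a := by exact_mod_cast ha
  have hK0 : 0 < K := by positivity
  have hnk : 0 < (n : ℝ) ^ (k - 1) := by positivity
  have hp0 : 0 ≤ p := by
    by_contra! h
    have : p * (n : ℝ) ^ (k - 1) ≤ 0 := mul_nonpos_of_nonpos_of_nonneg h.le hnk.le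
    have : 0 < 17 * a * K := by positivity
    linarith
  set I : Finset (Equiv.Perm (Fin n) × Equiv.Perm (Fin qc)) := G ×ˢ univ with hI
  set S : Equiv.Perm (Fin n) × Equiv.Perm (Fin qc) → Finset (Finset (Fin n) × Fin qc) :=
    fun x => colouredEdges (M x.1) (ι x.1) x.2 with hS
  have hIG : ∀ x ∈ I, x.1 ∈ G := fun x hx => (mem_product.1 hx).1
  set p₀ : ℝ := K / ((n : ℝ) ^ (k - 1) * qc) with hp₀
  have hp₀0 : 0 < p₀ := by positivity
  have hle : (16 * a + a) * p₀ ≤ p / qc := by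
    rw [hp₀, ← mul_div_assoc, div_le_div_iff₀ (by positivity) hqc']
    calc (16 * a + a) * K * qc = 17 * a * K * qc := by ring
      _ ≤ (p * (n : ℝ) ^ (k - 1)) * qc := by gcongr
      _ = _ := by ring
  have hpqc : p / qc ≤ 1 := by
    rw [div_le_one hqc']
    have : (1 : ℝ) ≤ qc := by exact_mod_cast hqc0
    linarith
  have hcover := hasCover_of_card_le (X := H ×ˢ (univ : Finset (Fin qc))) hp₀0
    (L := a) (by linarith) B hB a (hle.trans hpqc) (I.image S)
    (fun T hT => by
      obtain ⟨x, hx, rfl⟩ := mem_image.1 hT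
      intro y hy
      obtain ⟨e, he, rfl⟩ := mem_image.1 hy
      exact mem_product.2 ⟨(hMι _ (hIG x hx)).1 he, mem_univ _⟩)
    (fun T hT => by
      obtain ⟨x, hx, rfl⟩ := mem_image.1 hT
      refine card_image_le.trans ((hMι _ (hIG x hx)).2.2.2.2.1.trans (han.trans ?_))
      exact Nat.le_mul_of_pos_right _ hB)
  have h1 := one_le_of_hasCover (hG0.product univ_nonempty) S (fun T => by
      have h2 := card_pairs_subset_colouredEdges_le hk hn blk hw0 hw G hG M
        (fun π hπ E hE => hH E ((hMι π hπ).1 hE)) (fun π hπ => (hMι π hπ).2.1)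
        (fun π hπ => (hMι π hπ).2.2.2.1) ι (fun π hπ => (hMι π hπ).2.2.2.2.2) T
      rw [hp₀, div_pow, div_mul_eq_mul_div, le_div_iff₀ (by positivity), card_product, card_univ]
      push_cast
      exact h2) hcover
  have h2 : bern ((16 * a + a) * p₀) (H ×ˢ (univ : Finset (Fin qc))) (upInd (I.image S)) ≤
      bern (p / qc) (H ×ˢ (univ : Finset (Fin qc))) (upInd (I.image S)) :=
    bern_mono_prob (by positivity) hle hpqc _ fun W W' =>
      upInd_mono fun ⟨T, hT, h⟩ => ⟨T, hT, h.trans subset_union_left⟩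
  have : Nonempty (Fin qc) := ⟨⟨0, hqc0⟩⟩
  have h3 := bern_pairs_le_bern_colouring hp0 hp1 H (upInd (I.image S))
    (fibreSubadditive_upInd _ fun T hT x hx y hy hxy => by
      obtain ⟨z, hz, rfl⟩ := mem_image.1 hT
      obtain ⟨e, he, rfl⟩ := mem_image.1 hx
      obtain ⟨e', he', rfl⟩ := mem_image.1 hy
      dsimp only at hxy
      rw [hxy])
  rw [Fintype.card_fin] at h3
  have h4 : (bern p H fun R => ((qc : ℝ) ^ Fintype.card (Finset (Fin n)))⁻¹ *
      ∑ c : Finset (Fin n) → Fin qc, upInd (I.image S) (R.image fun e => (e, c e))) ≤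
      rainbowPMProb n qc p H := by
    rw [rainbowPMProb_eq]
    refine bern_mono hp0 hp1 fun R _ => mul_le_mul_of_nonneg_left ?_ (by positivity)
    refine sum_le_sum fun c _ => ?_
    unfold upInd
    split_ifs with h5 h6 h6
    · exact le_rfl
    · refine absurd ?_ h6
      obtain ⟨T, hT, hTR⟩ := h5
      obtain ⟨x, hx, rfl⟩ := mem_image.1 hT
      obtain ⟨-, h7, h8, -, -, h9⟩ := hMι x.1 (hIG x hx)
      have h10 : ∀ e ∈ M x.1, e ∈ R ∧ c e = x.2 (ι x.1 e) := by
        intro e he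
        obtain ⟨e', he', hee⟩ := mem_image.1 (hTR (mem_image_of_mem _ he))
        obtain ⟨rfl, h12⟩ := Prod.mk.inj hee
        exact ⟨he', h12⟩
      refine ⟨M x.1, fun e he => (h10 e he).1, h7, h8, fun E₁ hE₁ E₂ hE₂ hc => ?_⟩
      rw [(h10 E₁ hE₁).2, (h10 E₂ hE₂).2] at hc
      exact h9 hE₁ hE₂ (x.2.injective hc)
    · exact zero_le_one
    · exact le_rfl
  have h5 : (1 / 2 : ℝ) ^ B * (1 - (1 / 2) ^ a) ≤ (1 / 2) ^ B :=
    mul_le_of_le_one_right (by positivity) (by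
      have : (0 : ℝ) < (1 / 2) ^ a := by positivity
      linarith)
  linarith [h2.trans (h3.trans h4)]

end Transfer

open Filter Topology

/-- Let `1 ≤ ℓ < k`, `ε > 0`, and let `dirac` be the `ℓ`-degree Dirac threshold
`δ⁺_{ℓ,k} = lim_{k∣n, n→∞} t(n,k,ℓ)/C(n,k-ℓ)`. There is `C = C(ℓ,k,ε)` such that,
uniformly over all `n`-vertex `k`-uniform hypergraphs `H` (with `k ∣ n`) satisfying
`δ_ℓ(H) ≥ (δ⁺_{ℓ,k} + ε)·C(n-ℓ,k-ℓ)`: if the edges of `H` are colored independently and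
uniformly at random with `q ≥ n/k` colors, then `H_{C log n / n^{k-1}}` contains a rainbow
perfect matching with probability tending to `1` as `n → ∞`. -/
theorem rainbow_perfect_matching (k l : ℕ) (hl : 1 ≤ l) (hlk : l < k)
    (ε : ℝ) (hε : 0 < ε) (dirac : ℝ)
    (hdirac : Filter.Tendsto
      (fun m : ℕ => (tPM (k * m) k l : ℝ) / (Nat.choose (k * m) (k - l) : ℝ))
      Filter.atTop (nhds dirac)) :
    ∃ C : ℝ, 0 < C ∧ ∀ ε' : ℝ, 0 < ε' → ∃ n₀ : ℕ, ∀ n : ℕ, n₀ ≤ n → k ∣ n →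
      ∀ H : Finset (Finset (Fin n)), (∀ E ∈ H, E.card = k) →
        (∀ T : Finset (Fin n), T.card = l →
          (dirac + ε) * (Nat.choose (n - l) (k - l) : ℝ) ≤ (degOf H T : ℝ)) →
        ∀ qc : ℕ, n / k ≤ qc →
          1 - ε' ≤ rainbowPMProb n qc (C * Real.log n / (n : ℝ) ^ (k - 1)) H := by
  obtain ⟨w, hw0, n₁, hspread⟩ := exists_spread_matchings k l hl hlk ε hε dirac hdirac
  have hw0' : (0 : ℝ) < w := by exact_mod_cast hw0
  set K : ℝ := (w : ℝ) ^ (k - 1) * Real.exp 2 ^ k * Real.exp 1 with hK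
  have hK0 : 0 < K := by positivity
  refine ⟨17 * 4 * K, by positivity, fun ε' hε' => ?_⟩
  obtain ⟨B', hB'⟩ := exists_pow_lt_of_lt_one (half_pos hε') (show (1 / 2 : ℝ) < 1 by norm_num)
  set B := B' + 1 with hB
  have hBε : (1 / 2 : ℝ) ^ B ≤ ε' / 2 :=
    (pow_le_pow_of_le_one (by norm_num) (by norm_num) (Nat.le_succ _)).trans hB'.le
  have e1 : ∀ᶠ a : ℕ in atTop, (1 + 1 / (a : ℝ)) ^ B - 1 < ε' / 2 := by
    have h1 : Tendsto (fun a : ℕ => (1 + 1 / (a : ℝ)) ^ B - 1) atTop (𝓝 ((1 + 0) ^ B - 1)) :=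
      ((tendsto_const_nhds.add tendsto_one_div_atTop_nhds_zero_nat).pow B).sub tendsto_const_nhds
    rw [add_zero, one_pow, sub_self] at h1
    exact h1.eventually (gt_mem_nhds (half_pos hε'))
  obtain ⟨a₀, ha₀⟩ := eventually_atTop.1 e1
  have e2 : ∀ᶠ n : ℕ in atTop, 17 * 4 * K * Real.log n / n ≤ 1 := by
    have h1 : Tendsto (fun n : ℕ => Real.log n / n) atTop (𝓝 0) := by
      have h2 := Real.tendsto_pow_log_div_mul_add_atTop 1 0 1 one_ne_zero
      simp only [pow_one, one_mul, add_zero] at h2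
      exact h2.comp tendsto_natCast_atTop_atTop
    have h3 := h1.const_mul (17 * 4 * K)
    rw [mul_zero] at h3
    filter_upwards [h3.eventually (gt_mem_nhds one_pos)] with n hn
    rw [mul_div_assoc]
    exact hn.le
  obtain ⟨n₂, hn₂⟩ := eventually_atTop.1 e2
  refine ⟨n₁ + n₂ + 2 ^ a₀ + k + 2, fun n hn hkn H hH hdeg qc hqc => ?_⟩
  have hpow : 0 < 2 ^ a₀ := by positivity
  obtain ⟨blk, hblk, G, hG0, hGH, hG⟩ := hspread n (by omega) hkn H hH hdeg
  have hqc0 : 0 < qc := lt_of_lt_of_le (Nat.div_pos (by omega) (by omega)) hqc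
  have hn0 : (0 : ℝ) < n := by exact_mod_cast (by omega : 0 < n)
  have hn1 : (1 : ℝ) ≤ n := by exact_mod_cast (by omega : 1 ≤ n)
  set a := Nat.log 2 n + 1 with ha
  have haa : a₀ ≤ a := by
    have : a₀ ≤ Nat.log 2 n := Nat.le_log_of_pow_le (by norm_num) (by omega)
    omega
  have halog : (a : ℝ) ≤ 4 * Real.log n := by
    have h1 : ((2 ^ Nat.log 2 n : ℕ) : ℝ) ≤ n := by
      exact_mod_cast Nat.pow_log_le_self 2 (by omega)
    have h2 := Real.log_le_log (by positivity) h1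
    push_cast at h2
    rw [Real.log_pow] at h2
    have h3 : Real.log 2 ≤ Real.log n :=
      Real.log_le_log (by norm_num) (by exact_mod_cast (by omega : 2 ≤ n))
    have h4 := Real.log_two_gt_d9
    have h5 : (0 : ℝ) ≤ (Nat.log 2 n : ℝ) := by positivity
    rw [ha]
    push_cast
    nlinarith
  have hlog : 0 ≤ Real.log n := Real.log_nonneg hn1
  have hmain := rainbowPMProb_ge (p := 17 * 4 * K * Real.log n / (n : ℝ) ^ (k - 1))
    (by omega) (by omega) hqc hqc0 blk hw0 hblk G hG0 hG H hH hGH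
    a B (by omega) (by omega) (Nat.lt_pow_succ_log_self (by norm_num) n).le ?_ ?_
  · have := ha₀ a haa
    linarith
  · refine le_trans ?_ (hn₂ n (by omega))
    gcongr
    exact le_self_pow₀ hn1 (by omega)
  · rw [div_mul_cancel₀ _ (by positivity), ← hK]
    calc 17 * a * K ≤ 17 * (4 * Real.log n) * K := by gcongr
      _ = _ := by ring
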